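/- Let (X0,X1) be a compatible (quasi-)Banach couple, 0 < θ1 < 1, let E, E1, F be r.i. spaces and a, b, b1 ∈ SV with ||b1||_{Ẽ1(0,1)} < ∞ and ||b||_{Ẽ(0,1)} < ∞. Set ρ(u) = u^{θ1} / (a(u) ||b1||_{Ẽ1(0,u)}) and B1(u) = ||b1||_{Ẽ1(0,u)} b(ρ(u)) for u > 0. Then (X0, X̄^R_{θ1,b1,E1,a,F})_{1,b,E} = X̄^R_{θ1,B1,E,a,F} ∩ X̄^{R,R}_{θ1, b∘ρ, E, b1, E1, a, F}, with equality of sets and equivalence of (quasi-)norms, the norm on the intersection being the maximum of the two norms. -/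

import Mathlib

open MeasureTheory Set ENNReal

noncomputable section

/-- The homogeneous measure `dt/t` on `(0,∞)`. -/
def homMeasure : Measure ℝ :=
  (volume.restrict (Set.Ioi (0:ℝ))).withDensity fun t => ENNReal.ofReal t⁻¹

/-- Abstraction of the functional `‖·‖_{Ẽ}` associated with a rearrangement invariant
Banach function space `E` over `((0,∞), dt)` with the Fatou property, transferred to the
homogeneous measure `dt/t` (so that `Ẽ = 𝓕(L̃₁, L∞)` when `E = 𝓕(L₁, L∞)`).
The norm is extended-real valued; membership in the space corresponds to finiteness. -/
structure RITildeNorm where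
  N : (ℝ → ℝ≥0∞) → ℝ≥0∞
  eq_on : ∀ f g : ℝ → ℝ≥0∞, (∀ t : ℝ, 0 < t → f t = g t) → N f = N g
  mono : ∀ f g : ℝ → ℝ≥0∞, (∀ t : ℝ, 0 < t → f t ≤ g t) → N f ≤ N g
  add_le : ∀ f g : ℝ → ℝ≥0∞, N (fun t => f t + g t) ≤ N f + N g
  smul : ∀ c : ℝ≥0∞, c ≠ ∞ → ∀ f : ℝ → ℝ≥0∞, N (fun t => c * f t) = c * N f
  rearrange_inv : ∀ f g : ℝ → ℝ≥0∞,
    (∀ lam : ℝ≥0∞, homMeasure {t | lam < f t} = homMeasure {t | lam < g t}) → N f = N g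
  fatou : ∀ f : ℕ → ℝ → ℝ≥0∞, (∀ n t, f n t ≤ f (n + 1) t) →
    N (fun t => ⨆ n, f n t) = ⨆ n, N (f n)

/-- `‖f‖_{Ẽ(s)}`, the norm in `Ẽ` of the restriction of `f` to the set `s`. -/
def RITildeNorm.on (E : RITildeNorm) (s : Set ℝ) (f : ℝ → ℝ≥0∞) : ℝ≥0∞ :=
  E.N (s.indicator f)

/-- `‖b‖_{Ẽ(s)}` for a real-valued (slowly varying) function `b`. -/
def svNorm (E : RITildeNorm) (s : Set ℝ) (b : ℝ → ℝ) : ℝ≥0∞ :=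
  E.on s (fun t => ENNReal.ofReal (b t))

/-- Two functions are equivalent on `(0,∞)` up to positive multiplicative constants. -/
def EquivOn (f g : ℝ → ℝ) : Prop :=
  ∃ c C : ℝ, 0 < c ∧ 0 < C ∧ ∀ t : ℝ, 0 < t → c * g t ≤ f t ∧ f t ≤ C * g t

/-- Slowly varying functions on `(0,∞)`: positive measurable functions `b` such that
for every `ε > 0`, `t ^ ε * b t` is equivalent to a non-decreasing function and
`t ^ (-ε) * b t` is equivalent to a non-increasing function on `(0,∞)`. -/
def SlowlyVarying (b : ℝ → ℝ) : Prop :=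
  Measurable b ∧ (∀ t : ℝ, 0 < t → 0 < b t) ∧
    ∀ ε : ℝ, 0 < ε →
      (∃ g : ℝ → ℝ, MonotoneOn g (Set.Ioi 0) ∧ EquivOn (fun t => t ^ ε * b t) g) ∧
      (∃ g : ℝ → ℝ, AntitoneOn g (Set.Ioi 0) ∧ EquivOn (fun t => t ^ (-ε) * b t) g)

/-- A (quasi-)Banach space continuously embedded in the ambient module `V`
(the compatible sum `X₀+X₁`), encoded through its extended-real valued quasi-norm
(`N x = ∞` exactly when `x` is not in the space); completeness is expressed through
convergence of Cauchy sequences of the space. -/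
structure IsQuasiNorm {V : Type*} [AddCommGroup V] [Module ℝ V] (N : V → ℝ≥0∞) : Prop where
  smul : ∀ (c : ℝ) (x : V), N (c • x) = ENNReal.ofReal |c| * N x
  quasi_triangle : ∃ C : ℝ≥0∞, 1 ≤ C ∧ C ≠ ∞ ∧ ∀ x y : V, N (x + y) ≤ C * (N x + N y)
  definite : ∀ x : V, N x = 0 → x = 0
  complete : ∀ u : ℕ → V, (∀ n, N (u n) < ∞) →
    (∀ ε : ℝ≥0∞, 0 < ε → ∃ M : ℕ, ∀ m n : ℕ, M ≤ m → M ≤ n → N (u m - u n) < ε) →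
    ∃ y : V, N y < ∞ ∧ ∀ ε : ℝ≥0∞, 0 < ε → ∃ M : ℕ, ∀ n : ℕ, M ≤ n → N (u n - y) < ε

variable {V : Type*} [AddCommGroup V] [Module ℝ V]

/-- The Peetre K-functional of the couple described by the quasi-norms `N0`, `N1`. -/
def Kfun (N0 N1 : V → ℝ≥0∞) (t : ℝ) (f : V) : ℝ≥0∞ :=
  ⨅ g : V, N0 g + ENNReal.ofReal t * N1 (f - g)

/-- `f ∈ X₀ + X₁`. -/
def InSum (N0 N1 : V → ℝ≥0∞) (f : V) : Prop :=
  ∃ g h : V, f = g + h ∧ N0 g < ∞ ∧ N1 h < ∞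

/-- Quasi-norm of the real interpolation space `X̄_{θ,b,E}`. -/
def spaceNorm (E : RITildeNorm) (θ : ℝ) (b : ℝ → ℝ) (N0 N1 : V → ℝ≥0∞) (f : V) : ℝ≥0∞ :=
  E.N (fun t => ENNReal.ofReal (t ^ (-θ) * b t) * Kfun N0 N1 t f)

/-- Quasi-norm of the space `X̄^𝓡_{θ,b,E,a,F}`. -/
def spaceNormR (θ : ℝ) (b : ℝ → ℝ) (E : RITildeNorm) (a : ℝ → ℝ) (F : RITildeNorm)
    (N0 N1 : V → ℝ≥0∞) (f : V) : ℝ≥0∞ :=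
  E.N (fun t => ENNReal.ofReal (b t) *
    F.on (Set.Ioi t) (fun s => ENNReal.ofReal (s ^ (-θ) * a s) * Kfun N0 N1 s f))

/-- Quasi-norm of the space `X̄^𝓛_{θ,b,E,a,F}`. -/
def spaceNormL (θ : ℝ) (b : ℝ → ℝ) (E : RITildeNorm) (a : ℝ → ℝ) (F : RITildeNorm)
    (N0 N1 : V → ℝ≥0∞) (f : V) : ℝ≥0∞ :=
  E.N (fun t => ENNReal.ofReal (b t) *
    F.on (Set.Ioo 0 t) (fun s => ENNReal.ofReal (s ^ (-θ) * a s) * Kfun N0 N1 s f))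

/-- Quasi-norm of the space `X̄^{𝓡,𝓡}_{θ,c,E,b,F,a,G}`. -/
def spaceNormRR (θ : ℝ) (c : ℝ → ℝ) (E : RITildeNorm) (b : ℝ → ℝ) (F : RITildeNorm)
    (a : ℝ → ℝ) (G : RITildeNorm) (N0 N1 : V → ℝ≥0∞) (f : V) : ℝ≥0∞ :=
  E.N (fun u => ENNReal.ofReal (c u) *
    F.on (Set.Ioi u) (fun t => ENNReal.ofReal (b t) *
      G.on (Set.Ioi t) (fun s => ENNReal.ofReal (s ^ (-θ) * a s) * Kfun N0 N1 s f)))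

/-- Quasi-norm of the space `X̄^{𝓛,𝓛}_{θ,c,E,b,F,a,G}`. -/
def spaceNormLL (θ : ℝ) (c : ℝ → ℝ) (E : RITildeNorm) (b : ℝ → ℝ) (F : RITildeNorm)
    (a : ℝ → ℝ) (G : RITildeNorm) (N0 N1 : V → ℝ≥0∞) (f : V) : ℝ≥0∞ :=
  E.N (fun u => ENNReal.ofReal (c u) *
    F.on (Set.Ioo 0 u) (fun t => ENNReal.ofReal (b t) *
      G.on (Set.Ioo 0 t) (fun s => ENNReal.ofReal (s ^ (-θ) * a s) * Kfun N0 N1 s f)))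

def JJ (x : ℝ) : Set ℝ := Set.Ico x (2 * x)

lemma hom_JJ (x : ℝ) (hx : 0 < x) : homMeasure (JJ x) = ENNReal.ofReal (Real.log 2) := by
  unfold homMeasure JJ
  rw [withDensity_apply _ measurableSet_Ico, Measure.restrict_restrict measurableSet_Ico,
    show Set.Ico x (2*x) ∩ Set.Ioi 0 = Set.Ico x (2*x) from
      Set.inter_eq_left.2 (fun y hy => lt_of_lt_of_le hx hy.1),
    ← ofReal_integral_eq_lintegral_ofReal]
  · rw [integral_Ico_eq_integral_Ioc, ← intervalIntegral.integral_of_le (by linarith),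
      integral_inv_of_pos hx (by linarith)]
    congr 2
    field_simp
  · have : IntegrableOn (fun t : ℝ => t⁻¹) (Set.Icc x (2*x)) := by
      apply ContinuousOn.integrableOn_Icc
      intro y hy
      have : y ≠ 0 := by have := hy.1; linarith
      exact (continuousAt_inv₀ this).continuousWithinAt
    exact this.mono_set Set.Ico_subset_Icc_self
  · filter_upwards [ae_restrict_mem measurableSet_Ico] with y hy
    have := hy.1
    exact inv_nonneg.2 (by linarith)

lemma hom_ac : homMeasure ≪ volume :=
  (withDensity_absolutelyContinuous _ _).trans Measure.absolutelyContinuous_restrict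

namespace RITildeNorm
variable (E : RITildeNorm)

lemma zero' : E.N (fun _ => 0) = 0 := by
  have := E.smul 0 (by simp) (fun _ => 0)
  simpa using this

lemma smul' (c : ℝ≥0∞) (f : ℝ → ℝ≥0∞) : E.N (fun t => c * f t) = c * E.N f := by
  by_cases hc : c = ∞
  · subst hc
    have h := E.fatou (fun n t => (n : ℝ≥0∞) * f t) (fun n t => by
      gcongr; simp)
    have h2 : (fun t => ∞ * f t) = fun t => ⨆ n : ℕ, (n : ℝ≥0∞) * f t := by
      funext t
      rw [← ENNReal.iSup_mul, ENNReal.iSup_natCast]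
    rw [h2, h]
    simp_rw [E.smul _ (ENNReal.natCast_ne_top _)]
    rw [← ENNReal.iSup_mul, ENNReal.iSup_natCast]
  · exact E.smul c hc f

/-- monotone off a point -/
lemma mono_off (u : ℝ) (f g : ℝ → ℝ≥0∞) (h : ∀ t, 0 < t → t ≠ u → f t ≤ g t) :
    E.N f ≤ E.N g := by
  classical
  have h1 : E.N f = E.N (Function.update f u 0) := by
    apply E.rearrange_inv
    intro lam
    apply measure_congr
    have : ∀ᵐ t ∂homMeasure, t ≠ u := by
      apply hom_ac.ae_le
      exact Measure.ae_ne volume u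
    filter_upwards [this] with t ht
    apply propext
    change lam < f t ↔ lam < Function.update f u 0 t
    rw [Function.update_of_ne ht]
  rw [h1]
  apply E.mono
  intro t ht
  by_cases hu : t = u
  · subst hu; simp
  · rw [Function.update_of_ne hu]; exact h t ht hu

lemma sum_le (M : ℕ) (f : ℕ → ℝ → ℝ≥0∞) :
    E.N (fun t => ∑ n ∈ Finset.range M, f n t) ≤ ∑ n ∈ Finset.range M, E.N (f n) := by
  induction M with
  | zero => simpa using E.zero'.le
  | succ k ih =>
    simp_rw [Finset.sum_range_succ]
    exact (E.add_le _ _).trans (add_le_add ih le_rfl)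

lemma tsum_le (f : ℕ → ℝ → ℝ≥0∞) :
    E.N (fun t => ∑' n, f n t) ≤ ∑' n, E.N (f n) := by
  have h := E.fatou (fun M t => ∑ n ∈ Finset.range M, f n t) (fun n t => by
    rw [Finset.sum_range_succ]; exact le_self_add)
  simp_rw [← ENNReal.tsum_eq_iSup_nat] at h
  rw [h]
  exact iSup_le fun M => (E.sum_le M f).trans (ENNReal.sum_le_tsum _)

lemma tsum_le' {ι : Type*} [Denumerable ι] (f : ι → ℝ → ℝ≥0∞) :
    E.N (fun t => ∑' n, f n t) ≤ ∑' n, E.N (f n) := by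
  have := E.tsum_le (fun n => f ((Denumerable.eqv ι).symm n))
  have h1 : ∀ t, ∑' n, f ((Denumerable.eqv ι).symm n) t = ∑' n, f n t := fun t =>
    (Denumerable.eqv ι).symm.tsum_eq (fun i => f i t)
  have h2 : ∑' n, E.N (f ((Denumerable.eqv ι).symm n)) = ∑' n, E.N (f n) :=
    (Denumerable.eqv ι).symm.tsum_eq (fun i => E.N (f i))
  simp_rw [h1] at this
  rw [h2] at this
  exact this

def kap : ℝ≥0∞ := E.N ((JJ 1).indicator fun _ => 1)

lemma ind_JJ (x : ℝ) (hx : 0 < x) : E.N ((JJ x).indicator fun _ => 1) = E.kap := by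
  apply E.rearrange_inv
  intro lam
  by_cases hl : lam < 1
  · have : ∀ y, {t | lam < (JJ y).indicator (fun _ => (1:ℝ≥0∞)) t} = JJ y := by
      intro y; ext t
      by_cases ht : t ∈ JJ y <;> simp [ht, hl]
    rw [this, this, hom_JJ x hx, hom_JJ 1 one_pos]
  · have : ∀ y, {t | lam < (JJ y).indicator (fun _ => (1:ℝ≥0∞)) t} = ∅ := by
      intro y; ext t
      by_cases ht : t ∈ JJ y <;> simp [ht]
      simpa using hl
    rw [this, this]

lemma ind_JJ_c (x : ℝ) (hx : 0 < x) (c : ℝ≥0∞) :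
    E.N ((JJ x).indicator fun _ => c) = c * E.kap := by
  rw [← E.ind_JJ x hx, ← E.smul']
  congr 1; funext t
  by_cases ht : t ∈ JJ x <;> simp [ht]

lemma lower (x : ℝ) (hx : 0 < x) (c : ℝ≥0∞) (f : ℝ → ℝ≥0∞) (h : ∀ t ∈ JJ x, c ≤ f t) :
    c * E.kap ≤ E.N f := by
  rw [← E.ind_JJ_c x hx]
  apply E.mono
  intro t _
  by_cases ht : t ∈ JJ x
  · simpa [ht] using h t ht
  · simp [ht]

end RITildeNorm

lemma exists_JJ (s : ℝ) (hs : 0 < s) : ∃ n : ℤ, s ∈ JJ ((2:ℝ) ^ n) := by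
  obtain ⟨n, hn⟩ := exists_mem_Ico_zpow (x := s) (y := (2:ℝ)) hs (by norm_num)
  refine ⟨n, hn.1, ?_⟩
  have := hn.2
  rwa [zpow_add_one₀ (by norm_num), mul_comm] at this

lemma JJ_unique (s : ℝ) (n m : ℤ) (h : s ∈ JJ ((2:ℝ) ^ n)) (h' : s ∈ JJ ((2:ℝ) ^ m)) : n = m := by
  have key : ∀ n m : ℤ, s ∈ JJ ((2:ℝ) ^ n) → s ∈ JJ ((2:ℝ) ^ m) → n ≤ m := by
    intro n m h h'
    have h1 := h.1.trans_lt h'.2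
    rw [mul_comm, ← zpow_add_one₀ (by norm_num), zpow_lt_zpow_iff_right₀ (show (1:ℝ) < 2 by norm_num)] at h1
    omega
  exact le_antisymm (key _ _ h h') (key _ _ h' h)

lemma RITildeNorm.zero_of_kap (E : RITildeNorm) (h : E.kap = 0) (f : ℝ → ℝ≥0∞) : E.N f = 0 := by
  have h1 := E.tsum_le' (ι := ℤ × ℕ) (fun p => (JJ ((2:ℝ) ^ p.1)).indicator fun _ => 1)
  have h2 : ∀ p : ℤ × ℕ, E.N ((JJ ((2:ℝ) ^ p.1)).indicator fun _ => 1) = 0 := fun p => by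
    rw [E.ind_JJ _ (by positivity), h]
  simp only [h2, tsum_zero] at h1
  apply le_antisymm _ (zero_le)
  refine le_trans (E.mono _ _ ?_) h1
  intro t ht
  obtain ⟨n, hn⟩ := exists_JJ t ht
  rw [ENNReal.tsum_prod (f := fun (n : ℤ) (_ : ℕ) => (JJ ((2:ℝ) ^ n)).indicator (fun _ => (1:ℝ≥0∞)) t)]
  refine le_trans ?_ (ENNReal.le_tsum n)
  simp [hn]

/-- log distance -/
def dd (s u : ℝ) : ℝ := |Real.log s - Real.log u|

lemma dd_comm (s u : ℝ) : dd s u = dd u s := abs_sub_comm _ _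
lemma dd_nonneg (s u : ℝ) : 0 ≤ dd s u := abs_nonneg _
lemma dd_tri (s t u : ℝ) : dd s u ≤ dd s t + dd t u := abs_sub_le _ _ _
lemma dd_of_le {s u : ℝ} (hs : 0 < s) (h : s ≤ u) : dd s u = Real.log u - Real.log s := by
  unfold dd
  rw [abs_sub_comm, abs_of_nonneg]
  linarith [Real.log_le_log hs h]

lemma dd_JJ {s x : ℝ} (hx : 0 < x) (h : s ∈ JJ x) : dd x s ≤ Real.log 2 := by
  rw [dd_of_le hx h.1]
  have := Real.log_le_log (lt_of_lt_of_le hx h.1) h.2.le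
  rw [Real.log_mul (by norm_num) hx.ne'] at this
  linarith

lemma RITildeNorm.expo (E : RITildeNorm) (δ : ℝ) (hδ : 0 < δ) : ∃ C : ℝ≥0∞, C ≠ ∞ ∧ ∀ u : ℝ, 0 < u →
    E.N (fun s => ENNReal.ofReal (Real.exp (- δ * dd s u))) ≤ C * E.kap := by
  set r : ℝ≥0∞ := ENNReal.ofReal (Real.exp (-δ * Real.log 2)) with hr
  have hl2 : 0 < Real.log 2 := Real.log_pos one_lt_two
  have hr1 : r < 1 := by
    rw [hr, ENNReal.ofReal_lt_one, Real.exp_lt_one_iff]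
    nlinarith
  refine ⟨2 * (1 - r)⁻¹, ?_, fun u hu => ?_⟩
  · apply ENNReal.mul_ne_top (by simp)
    exact ENNReal.inv_ne_top.2 (tsub_pos_of_lt hr1).ne'
  · have h1 := E.tsum_le (fun j s => (JJ (2 ^ j * u)).indicator (fun _ => r ^ j) s +
      (JJ (u * (2 ^ (j+1))⁻¹)).indicator (fun _ => r ^ j) s)
    have h2 : ∀ j : ℕ, E.N (fun s => (JJ (2 ^ j * u)).indicator (fun _ => r ^ j) s +
      (JJ (u * (2 ^ (j+1))⁻¹)).indicator (fun _ => r ^ j) s) ≤ r ^ j * (2 * E.kap) := by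
      intro j
      refine (E.add_le _ _).trans ?_
      rw [E.ind_JJ_c _ (by positivity), E.ind_JJ_c _ (by positivity)]
      rw [← two_mul, mul_left_comm]
    have h3 := h1.trans (ENNReal.tsum_le_tsum h2)
    rw [ENNReal.tsum_mul_right, ENNReal.tsum_geometric] at h3
    have h4 : (2 * (1 - r)⁻¹) * E.kap = (1 - r)⁻¹ * (2 * E.kap) := by ring
    rw [h4]
    refine le_trans (E.mono _ _ ?_) h3
    intro s hs
    have hpow : ∀ j : ℕ, r ^ j = ENNReal.ofReal (Real.exp (-δ * (j * Real.log 2))) := by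
      intro j
      rw [hr, ← ENNReal.ofReal_pow (Real.exp_pos _).le, ← Real.exp_nat_mul]
      congr 2; ring
    obtain ⟨n, hn⟩ := exists_JJ (s / u) (by positivity)
    obtain ⟨hn1, hn2⟩ := hn
    rw [le_div_iff₀ hu] at hn1
    rw [div_lt_iff₀ hu] at hn2
    obtain ⟨j, rfl | rfl⟩ : ∃ j : ℕ, n = j ∨ n = -((j:ℤ)+1) := by
      rcases n with j | j
      · exact ⟨j, Or.inl rfl⟩
      · exact ⟨j, Or.inr (by rw [Int.negSucc_eq])⟩
    · refine le_trans ?_ (ENNReal.le_tsum j)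
      refine le_trans ?_ le_self_add
      have hm : s ∈ JJ (2 ^ j * u) := by
        constructor
        · simpa using hn1
        · simpa [mul_assoc] using hn2
      rw [Set.indicator_of_mem hm, hpow]
      apply ENNReal.ofReal_le_ofReal
      rw [Real.exp_le_exp]
      have hus : u ≤ s := by
        refine le_trans ?_ hm.1
        have : (1:ℝ) ≤ 2 ^ j := one_le_pow₀ (by norm_num)
        nlinarith
      rw [dd_comm, dd_of_le hu hus]
      have := Real.log_le_log (by positivity) hm.1
      rw [Real.log_mul (by positivity) hu.ne', Real.log_pow] at this
      nlinarith
    · refine le_trans ?_ (ENNReal.le_tsum j)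
      refine le_trans ?_ le_add_self
      have he : (2:ℝ) ^ (-((j:ℤ)+1)) = (2 ^ (j+1))⁻¹ := by
        rw [zpow_neg]; norm_cast
      rw [he] at hn1 hn2
      have hm : s ∈ JJ (u * (2 ^ (j+1))⁻¹) := by
        constructor
        · linarith
        · linarith
      rw [Set.indicator_of_mem hm, hpow]
      apply ENNReal.ofReal_le_ofReal
      rw [Real.exp_le_exp]
      have h5 : s < (2 ^ j)⁻¹ * u := by
        have : (2:ℝ) * (2 ^ (j+1))⁻¹ = (2 ^ j)⁻¹ := by rw [pow_succ]; field_simp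
        rwa [this] at hn2
      have hsu : s ≤ u := by
        refine h5.le.trans ?_
        have : ((2:ℝ) ^ j)⁻¹ ≤ 1 := inv_le_one_of_one_le₀ (one_le_pow₀ (by norm_num))
        nlinarith
      rw [dd_of_le hs hsu]
      have := Real.log_le_log (by positivity) h5.le
      rw [Real.log_mul (by positivity) hu.ne', Real.log_inv, Real.log_pow] at this
      nlinarith

def stp (τ : ℤ → ℤ) (A : Set ℤ) (p : ℤ → ℝ≥0∞) (t : ℝ) : ℝ≥0∞ :=
  ⨆ n ∈ A, (JJ ((2:ℝ) ^ (τ n))).indicator (fun _ => p n) t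

lemma hom_stp (τ : ℤ → ℤ) (A : Set ℤ) (hA : Set.InjOn τ A) (p : ℤ → ℝ≥0∞) (lam : ℝ≥0∞) :
    homMeasure {t | lam < stp τ A p t} =
      ∑' _ : {n : ℤ | n ∈ A ∧ lam < p n}, ENNReal.ofReal (Real.log 2) := by
  have h1 : {t | lam < stp τ A p t} = ⋃ n ∈ {n : ℤ | n ∈ A ∧ lam < p n}, JJ ((2:ℝ) ^ (τ n)) := by
    ext t
    simp only [stp, Set.mem_ofPred_eq, lt_iSup_iff, Set.mem_iUnion]
    constructor
    · rintro ⟨n, hn, h⟩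
      by_cases ht : t ∈ JJ ((2:ℝ) ^ (τ n))
      · exact ⟨n, ⟨hn, by simpa [ht] using h⟩, ht⟩
      · simp [ht] at h
    · rintro ⟨n, ⟨hn, h⟩, ht⟩
      exact ⟨n, hn, by simpa [ht] using h⟩
  rw [h1, measure_biUnion (Set.to_countable _)]
  · congr 1; funext n
    exact hom_JJ _ (by positivity)
  · intro n hn m hm hnm
    rw [Function.onFun, Set.disjoint_left]
    intro s hs hs'
    exact hnm (hA hn.1 hm.1 (JJ_unique s _ _ hs hs'))
  · intro n _
    exact measurableSet_Ico

lemma RITildeNorm.discr (E : RITildeNorm) (P Q : ℝ → ℝ≥0∞) (σ : ℤ → ℤ) (M : ℕ) (hM : 0 < M)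
    (C : ℝ≥0∞) (h : ∀ n : ℤ, ∀ t ∈ JJ ((2:ℝ) ^ n), ∀ s ∈ JJ ((2:ℝ) ^ (σ n)), P t ≤ C * Q s)
    (hinj : ∀ n m : ℤ, σ n = σ m → n % M = m % M → n = m) : E.N P ≤ M * C * E.N Q := by
  set p : ℤ → ℝ≥0∞ := fun n => ⨆ t ∈ JJ ((2:ℝ) ^ n), P t with hp
  set A : ℕ → Set ℤ := fun j => {n : ℤ | n % M = j}
  have h1 : E.N P ≤ E.N (fun t => ∑ j ∈ Finset.range M, stp id (A j) p t) := by
    apply E.mono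
    intro t ht
    obtain ⟨n, hn⟩ := exists_JJ t ht
    have hM' : (M:ℤ) ≠ 0 := by exact_mod_cast hM.ne'
    have h0 := Int.emod_nonneg n hM'
    have h00 := Int.emod_lt_of_pos n (show (0:ℤ) < M by exact_mod_cast hM)
    refine le_trans ?_ (Finset.single_le_sum (f := fun j => stp id (A j) p t)
      (fun _ _ => zero_le) (a := (n % M).toNat) (by simp; omega))
    have hnA : n ∈ A (n % M).toNat := by
      simp [A, Int.toNat_of_nonneg h0]
    refine le_trans ?_ (le_iSup₂ (f := fun n (_ : n ∈ A (_ : ℕ)) =>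
      (JJ ((2:ℝ) ^ (id n))).indicator (fun _ => p n) t) n hnA)
    simp only [id, Set.indicator_of_mem hn]
    exact le_iSup₂ (f := fun t (_ : t ∈ JJ ((2:ℝ) ^ n)) => P t) t hn
  refine h1.trans ((E.sum_le M _).trans ?_)
  have h2 : ∀ j ∈ Finset.range M, E.N (stp id (A j) p) ≤ C * E.N Q := by
    intro j _
    have h3 : E.N (stp id (A j) p) = E.N (stp σ (A j) p) := by
      apply E.rearrange_inv
      intro lam
      rw [hom_stp _ _ (Function.injective_id.injOn), hom_stp]
      intro n hn m hm hnm
      exact hinj n m hnm (hn.trans hm.symm)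
    rw [h3, ← E.smul']
    apply E.mono
    intro s _
    refine iSup₂_le fun n hn => ?_
    by_cases hs : s ∈ JJ ((2:ℝ) ^ (σ n))
    · simp only [Set.indicator_of_mem hs]
      exact iSup₂_le fun t ht => h n t ht s hs
    · simp [hs]
  refine (Finset.sum_le_sum h2).trans ?_
  simp [mul_assoc]

lemma log2z (n : ℤ) : Real.log ((2:ℝ) ^ n) = n * Real.log 2 := Real.log_zpow _ _

lemma RITildeNorm.coarse (E : RITildeNorm) (ρ : ℝ → ℝ) (hρ0 : ∀ t, 0 < t → 0 < ρ t) (A θ B L : ℝ)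
    (hA : 0 ≤ A) (hθ : 0 < θ) (hL : 0 ≤ L) (hB : 0 ≤ B)
    (hρ : ∀ s u, 0 < s → 0 < u → |Real.log (ρ s) - Real.log (ρ u) - θ * (Real.log s - Real.log u)|
      ≤ A + θ / 2 * dd s u) :
    ∃ C : ℝ≥0∞, C ≠ ∞ ∧ ∀ G : ℝ → ℝ≥0∞,
      (∀ s u, 0 < s → 0 < u → G s ≤ ENNReal.ofReal (B * Real.exp (L * dd s u)) * G u) →
      E.N G ≤ C * E.N (fun u => G (ρ u)) ∧ E.N (fun u => G (ρ u)) ≤ C * E.N G := by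
  set l := Real.log 2 with hl
  have hl0 : 0 < l := Real.log_pos one_lt_two
  -- upper Lipschitz
  have hup : ∀ s u, 0 < s → 0 < u → dd (ρ s) (ρ u) ≤ A + 3 * θ / 2 * dd s u := by
    intro s u hs hu
    have h1 := hρ s u hs hu
    have h2 : dd (ρ s) (ρ u) ≤ |Real.log (ρ s) - Real.log (ρ u) - θ * (Real.log s - Real.log u)|
        + |θ * (Real.log s - Real.log u)| := by
      unfold dd
      have := abs_add_le (Real.log (ρ s) - Real.log (ρ u) - θ * (Real.log s - Real.log u))
        (θ * (Real.log s - Real.log u))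
      simpa using this
    rw [abs_mul, abs_of_pos hθ] at h2
    unfold dd at *
    linarith
  -- lower
  have hlow : ∀ n m : ℤ, n ≤ m → θ / 2 * l * (m - n) - A ≤
      Real.log (ρ (2 ^ m)) - Real.log (ρ (2 ^ n)) := by
    intro n m hnm
    have h1 := hρ ((2:ℝ)^m) ((2:ℝ)^n) (by positivity) (by positivity)
    have h3 : (n:ℝ) ≤ m := by exact_mod_cast hnm
    have h2 : dd ((2:ℝ)^m) ((2:ℝ)^n) = (m - n) * l := by
      unfold dd
      rw [log2z, log2z, ← sub_mul, abs_of_nonneg (mul_nonneg (by linarith) hl0.le)]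
    rw [h2, log2z, log2z] at h1
    have := (abs_le.1 h1).1
    linarith
  -- direction A data
  set D : ℝ := A + 3 * θ / 2 * l + (A + 3 * θ / 2 * l) + 2 * l with hD
  obtain ⟨M1, hM1⟩ := exists_nat_gt ((A + l) / (θ / 2 * l))
  have hM1' : A + l < θ / 2 * l * M1 := by
    rw [div_lt_iff₀ (by positivity)] at hM1; linarith
  obtain ⟨M2, hM2⟩ := exists_nat_gt ((A + 3 * θ / 2 * l) / l)
  have hM2' : A + 3 * θ / 2 * l < l * M2 := by
    rw [div_lt_iff₀ (by positivity)] at hM2; linarith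
  have hM1p : 0 < M1 := by
    rcases Nat.eq_zero_or_pos M1 with h | h
    · subst h; simp at hM1'; linarith
    · exact h
  have hM2p : 0 < M2 := by
    rcases Nat.eq_zero_or_pos M2 with h | h
    · subst h; simp at hM2'
      have : 0 < 3 * θ / 2 * l := by positivity
      linarith
    · exact h
  have hmod : ∀ (M : ℕ), 0 < M → ∀ n m : ℤ, n % M = m % M → n < m → n + M ≤ m := by
    intro M hM n m h hlt
    have h1 : (M:ℤ) ∣ m - n := Int.ModEq.dvd h
    have := Int.le_of_dvd (by omega) h1
    omega
  set C0 := ENNReal.ofReal (B * Real.exp (L * D)) with hC0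
  have hGle : ∀ G : ℝ → ℝ≥0∞,
      (∀ s u, 0 < s → 0 < u → G s ≤ ENNReal.ofReal (B * Real.exp (L * dd s u)) * G u) →
      ∀ s u, 0 < s → 0 < u → dd s u ≤ D → G s ≤ C0 * G u := by
    intro G hG s u hs hu hd
    refine (hG s u hs hu).trans ?_
    gcongr
    apply ENNReal.ofReal_le_ofReal
    gcongr
  have hJpos : ∀ (n : ℤ) (t : ℝ), t ∈ JJ ((2:ℝ)^n) → 0 < t := fun n t ht =>
    lt_of_lt_of_le (by positivity) ht.1
  have hlip : ∀ (n : ℤ) (t : ℝ), t ∈ JJ ((2:ℝ)^n) → dd (ρ t) (ρ ((2:ℝ)^n)) ≤ A + 3 * θ / 2 * l := by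
    intro n t ht
    refine (hup t _ (hJpos n t ht) (by positivity)).trans ?_
    have := dd_JJ (by positivity) ht
    rw [dd_comm] at this
    gcongr
  have hθl : 0 < θ * l := by positivity
  refine ⟨(M1 + M2) * C0, ENNReal.mul_ne_top (by norm_cast; exact ENNReal.natCast_ne_top _) (by simp [hC0]),
    fun G hG => ⟨?_, ?_⟩⟩
  · -- direction B
    have hex : ∀ n : ℤ, ∃ k : ℤ, dd (ρ ((2:ℝ)^k)) ((2:ℝ)^n) ≤ A + 3 * θ / 2 * l ∧
        Real.log (ρ ((2:ℝ)^k)) ≤ n * l ∧ n * l < Real.log (ρ ((2:ℝ)^k)) + (A + 3 * θ / 2 * l) := by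
      intro n
      obtain ⟨k, hk1, hk2⟩ := Int.exists_greatest_of_bdd
        (P := fun k : ℤ => Real.log (ρ ((2:ℝ)^k)) ≤ n * l) (by
          obtain ⟨b, hb⟩ := exists_nat_gt ((n * l + A - Real.log (ρ ((2:ℝ)^(0:ℤ)))) / (θ / 2 * l))
          rw [div_lt_iff₀ (by positivity)] at hb
          refine ⟨b, fun z hz => ?_⟩
          by_contra hc
          push Not at hc
          have := hlow 0 z (by omega)
          have hzb : (b:ℝ) ≤ z := by exact_mod_cast hc.le
          have : (b:ℝ) * (θ / 2 * l) ≤ z * (θ / 2 * l) := by gcongr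
          push_cast at *
          linarith) (by
          obtain ⟨b, hb⟩ := exists_nat_gt ((-(n * l) + A + Real.log (ρ ((2:ℝ)^(0:ℤ)))) / (θ / 2 * l))
          rw [div_lt_iff₀ (by positivity)] at hb
          refine ⟨-b, ?_⟩
          have := hlow (-b) 0 (by omega)
          push_cast at *
          linarith)
      have hk3 : n * l < Real.log (ρ ((2:ℝ)^(k+1))) := by
        by_contra hc
        push Not at hc
        have := hk2 _ hc
        omega
      have h4 := hup ((2:ℝ)^(k+1)) ((2:ℝ)^k) (by positivity) (by positivity)
      have h5 : dd ((2:ℝ)^(k+1)) ((2:ℝ)^k) = l := by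
        unfold dd
        rw [log2z, log2z]
        push_cast
        rw [abs_of_nonneg] <;> linarith
      rw [h5] at h4
      have h6 := (abs_le.1 h4).2
      refine ⟨k, ?_, hk1, by linarith⟩
      unfold dd
      rw [log2z, abs_le]
      constructor <;> linarith
    choose σ hσ1 hσ2 hσ3 using hex
    have := E.discr G (fun u => G (ρ u)) σ M2 hM2p C0 (by
      intro n t ht s hs
      have hs0 := hJpos _ _ hs
      apply hGle G hG _ _ (hJpos _ _ ht) (hρ0 _ hs0)
      have h1 := dd_tri t (2^n) (ρ s)
      have h2 := dd_tri (2^n) (ρ ((2:ℝ)^(σ n))) (ρ s)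
      have h3 := hlip _ _ hs
      have h4 := hσ1 n
      rw [dd_comm] at h3 h4
      have h5 := dd_JJ (by positivity) ht
      rw [dd_comm] at h5
      linarith) (by
      have key : ∀ n m : ℤ, σ n = σ m → n % M2 = m % M2 → m ≤ n := by
        intro n m h h'
        by_contra hc
        push Not at hc
        have h1 := hmod M2 hM2p n m h' hc
        have h1' : (n:ℝ) + M2 ≤ m := by exact_mod_cast h1
        have h2 := hσ2 n
        have h3 := hσ3 m
        rw [← h] at h3
        have h2' := hσ3 n
        have h3' := hσ2 m
        rw [← h] at h3'
        have : ((n:ℝ) + M2) * l ≤ m * l := by gcongr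
        linarith
      intro n m h h'
      exact le_antisymm (key m n h.symm h'.symm) (key n m h h'))
    refine this.trans ?_
    gcongr
    exact le_add_self
  · set σ : ℤ → ℤ := fun n => ⌊Real.log (ρ ((2:ℝ)^n)) / l⌋ with hσ
    have hs1 : ∀ n, (σ n) * l ≤ Real.log (ρ ((2:ℝ)^n)) := by
      intro n
      have := Int.floor_le (Real.log (ρ ((2:ℝ)^n)) / l)
      rwa [le_div_iff₀ hl0] at this
    have hs2 : ∀ n, Real.log (ρ ((2:ℝ)^n)) < (σ n) * l + l := by
      intro n
      have := Int.lt_floor_add_one (Real.log (ρ ((2:ℝ)^n)) / l)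
      rw [div_lt_iff₀ hl0] at this
      simp only [hσ]
      linarith
    have := E.discr (fun u => G (ρ u)) G σ M1 hM1p C0 (by
      intro n t ht s hs
      have ht0 := hJpos _ _ ht
      apply hGle G hG _ _ (hρ0 _ ht0) (hJpos _ _ hs)
      have h1 := dd_tri (ρ t) (ρ (2^n)) s
      have h2 := dd_tri (ρ (2^n)) ((2:ℝ)^(σ n)) s
      have h3 := hlip _ _ ht
      have h4 : dd (ρ (2^n)) ((2:ℝ)^(σ n)) ≤ l := by
        unfold dd
        rw [log2z, abs_le]
        have := hs1 n
        have := hs2 n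
        constructor <;> linarith
      have h5 := dd_JJ (by positivity) hs
      linarith) (by
      have key : ∀ n m : ℤ, σ n = σ m → n % M1 = m % M1 → m ≤ n := by
        intro n m h h'
        by_contra hc
        push Not at hc
        have h1 := hmod M1 hM1p n m h' hc
        have h1' : (M1:ℝ) ≤ m - n := by
          have : (n:ℝ) + M1 ≤ m := by exact_mod_cast h1
          linarith
        have h2 := hlow n m hc.le
        have h3 := hs1 n
        have h4 := hs2 m
        rw [← h] at h4
        have : θ / 2 * l * M1 ≤ θ / 2 * l * (m - n) := by gcongr
        linarith
      intro n m h h'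
      exact le_antisymm (key m n h.symm h'.symm) (key n m h h'))
    refine this.trans ?_
    gcongr
    exact le_self_add

def SVP (b : ℝ → ℝ) : Prop := (∀ t, 0 < t → 0 < b t) ∧ ∀ ε : ℝ, 0 < ε → ∃ C : ℝ, 0 < C ∧
  ∀ s u, 0 < s → 0 < u → b s ≤ C * Real.exp (ε * dd s u) * b u

lemma exp_dd_le {s u : ℝ} (ε : ℝ) (hs : 0 < s) (h : s ≤ u) :
    Real.exp (ε * dd s u) = s ^ (-ε) * u ^ ε := by
  rw [dd_of_le hs h, Real.rpow_def_of_pos hs, Real.rpow_def_of_pos (hs.trans_le h), ← Real.exp_add]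
  congr 1; ring

lemma SlowlyVarying.svp {b : ℝ → ℝ} (h : SlowlyVarying b) : SVP b := by
  refine ⟨h.2.1, fun ε hε => ?_⟩
  obtain ⟨⟨g, hg, c, C, hc, hC, hgb⟩, ⟨g', hg', c', C', hc', hC', hgb'⟩⟩ := h.2.2 ε hε
  refine ⟨max (C / c) (C' / c'), lt_max_of_lt_left (by positivity), fun s u hs hu => ?_⟩
  have hbu := h.2.1 u hu
  rcases le_total s u with hsu | hsu
  · have h1 := (hgb s hs).2
    have h2 := (hgb u hu).1
    have h3 := hg hs hu hsu
    simp only at h1 h2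
    have h4 : s ^ ε * b s ≤ C / c * (u ^ ε * b u) := by
      calc s ^ ε * b s ≤ C * g u := h1.trans (by gcongr)
        _ = C / c * (c * g u) := by field_simp
        _ ≤ _ := by gcongr
    have h5 : b s ≤ C / c * Real.exp (ε * dd s u) * b u := by
      rw [exp_dd_le ε hs hsu]
      calc b s = s ^ (-ε) * (s ^ ε * b s) := by
            rw [← mul_assoc, ← Real.rpow_add hs]; simp
        _ ≤ s ^ (-ε) * (C / c * (u ^ ε * b u)) := by gcongr
        _ = _ := by ring
    refine h5.trans ?_
    gcongr
    exact le_max_left _ _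
  · have h1 := (hgb' s hs).2
    have h2 := (hgb' u hu).1
    have h3 := hg' hu hs hsu
    simp only at h1 h2
    have h4 : s ^ (-ε) * b s ≤ C' / c' * (u ^ (-ε) * b u) := by
      calc s ^ (-ε) * b s ≤ C' * g' u := h1.trans (by gcongr)
        _ = C' / c' * (c' * g' u) := by field_simp
        _ ≤ _ := by gcongr
    have h5 : b s ≤ C' / c' * Real.exp (ε * dd s u) * b u := by
      rw [dd_comm, exp_dd_le ε hu hsu]
      calc b s = s ^ ε * (s ^ (-ε) * b s) := by
            rw [← mul_assoc, ← Real.rpow_add hs]; simp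
        _ ≤ s ^ ε * (C' / c' * (u ^ (-ε) * b u)) := by gcongr
        _ = _ := by ring
    refine h5.trans ?_
    gcongr
    exact le_max_right _ _

lemma SVP.mul {a b : ℝ → ℝ} (ha : SVP a) (hb : SVP b) : SVP (fun t => a t * b t) := by
  refine ⟨fun t ht => mul_pos (ha.1 t ht) (hb.1 t ht), fun ε hε => ?_⟩
  obtain ⟨C, hC, h1⟩ := ha.2 (ε/2) (by positivity)
  obtain ⟨C', hC', h2⟩ := hb.2 (ε/2) (by positivity)
  refine ⟨C * C', by positivity, fun s u hs hu => ?_⟩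
  have := mul_le_mul (h1 s u hs hu) (h2 s u hs hu) (hb.1 s hs).le
    (mul_nonneg (by positivity) (ha.1 u hu).le)
  refine this.trans (le_of_eq ?_)
  have : Real.exp (ε * dd s u) = Real.exp (ε/2 * dd s u) * Real.exp (ε/2 * dd s u) := by
    rw [← Real.exp_add]; congr 1; ring
  rw [this]; ring

/-- decay of `s^(-θ) a(s)` to the right -/
lemma SVP.right {a : ℝ → ℝ} (ha : SVP a) {θ : ℝ} (hθ : 0 < θ) : ∃ C : ℝ, 0 < C ∧
    ∀ s u, 0 < u → u ≤ s → s ^ (-θ) * a s ≤ C * Real.exp (-(θ/2) * dd s u) * (u ^ (-θ) * a u) := by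
  obtain ⟨C, hC, h1⟩ := ha.2 (θ/2) (by positivity)
  refine ⟨C, hC, fun s u hu hus => ?_⟩
  have hs := hu.trans_le hus
  have h2 : s ^ (-θ) = Real.exp (-θ * dd s u) * u ^ (-θ) := by
    rw [dd_comm, exp_dd_le _ hu hus, mul_right_comm, ← Real.rpow_add hu]; simp
  calc s ^ (-θ) * a s ≤ s ^ (-θ) * (C * Real.exp (θ/2 * dd s u) * a u) := by
        gcongr; exact h1 s u hs hu
    _ = C * (Real.exp (-θ * dd s u) * Real.exp (θ/2 * dd s u)) * (u ^ (-θ) * a u) := by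
        rw [h2]; ring
    _ = _ := by rw [← Real.exp_add]; congr 3; ring

/-- growth of `s^(1-θ) a(s)` on the left -/
lemma SVP.left {a : ℝ → ℝ} (ha : SVP a) {θ : ℝ} (hθ : θ < 1) : ∃ C : ℝ, 0 < C ∧
    ∀ s u, 0 < s → s ≤ u → s / u * (s ^ (-θ) * a s) ≤
      C * Real.exp (-((1-θ)/2) * dd s u) * (u ^ (-θ) * a u) := by
  obtain ⟨C, hC, h1⟩ := ha.2 ((1-θ)/2) (by linarith)
  refine ⟨C, hC, fun s u hs hsu => ?_⟩
  have hu := hs.trans_le hsu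
  have h2 : s / u * s ^ (-θ) = Real.exp (-(1-θ) * dd s u) * u ^ (-θ) := by
    rw [exp_dd_le _ hs hsu, mul_assoc, ← Real.rpow_add hu, neg_neg]
    have e1 : s / u * s ^ (-θ) = (s ^ (1:ℝ) * s ^ (-θ)) * u ^ (-1:ℝ) := by
      rw [Real.rpow_one, Real.rpow_neg_one]; field_simp
    rw [e1, ← Real.rpow_add hs]
    congr 2 ; ring
  calc s / u * (s ^ (-θ) * a s) = (s / u * s ^ (-θ)) * a s := by ring
    _ ≤ (s / u * s ^ (-θ)) * (C * Real.exp ((1-θ)/2 * dd s u) * a u) := by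
        gcongr; exact h1 s u hs hu
    _ = C * (Real.exp (-(1-θ) * dd s u) * Real.exp ((1-θ)/2 * dd s u)) * (u ^ (-θ) * a u) := by
        rw [h2]; ring
    _ = _ := by rw [← Real.exp_add]; congr 3; ring

/-- two-sided bound for `s^(-θ) a(s)` -/
lemma SVP.pb {a : ℝ → ℝ} (ha : SVP a) (θ : ℝ) : ∃ C L : ℝ, 0 < C ∧ 0 ≤ L ∧
    ∀ s u, 0 < s → 0 < u → s ^ (-θ) * a s ≤ C * Real.exp (L * dd s u) * (u ^ (-θ) * a u) := by
  obtain ⟨C, hC, h1⟩ := ha.2 1 one_pos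
  refine ⟨C, |θ| + 1, hC, by positivity, fun s u hs hu => ?_⟩
  have h2 : s ^ (-θ) ≤ Real.exp (|θ| * dd s u) * u ^ (-θ) := by
    rw [Real.rpow_def_of_pos hs, Real.rpow_def_of_pos hu, ← Real.exp_add, Real.exp_le_exp]
    unfold dd
    rw [← abs_mul]
    have := neg_abs_le (θ * (Real.log s - Real.log u))
    linarith
  calc s ^ (-θ) * a s ≤ (Real.exp (|θ| * dd s u) * u ^ (-θ)) * (C * Real.exp (1 * dd s u) * a u) :=
        mul_le_mul h2 (h1 s u hs hu) (ha.1 s hs).le (by positivity)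
    _ = C * (Real.exp (|θ| * dd s u) * Real.exp (1 * dd s u)) * (u ^ (-θ) * a u) := by ring
    _ = _ := by rw [← Real.exp_add]; congr 3; ring

/-- lower bound of norms over `(u,∞)` and `(0,u)` -/
lemma dd_JJ2 {s u : ℝ} (hu : 0 < u) (h : s ∈ JJ (2 * u)) : dd u s ≤ 2 * Real.log 2 := by
  have h1 := dd_JJ (by positivity) h
  have h2 := dd_tri u (2*u) s
  have h3 : dd u (2 * u) = Real.log 2 := by
    rw [dd_of_le hu (by linarith), Real.log_mul (by norm_num) hu.ne']; ring
  linarith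

lemma dd_JJ4 {s u : ℝ} (hu : 0 < u) (h : s ∈ JJ (u / 4)) : dd u s ≤ 3 * Real.log 2 := by
  have h1 := dd_JJ (by positivity) h
  have h2 := dd_tri u (u/4) s
  have h3 : dd u (u / 4) = 2 * Real.log 2 := by
    rw [dd_comm, dd_of_le (by positivity) (by linarith), Real.log_div hu.ne' (by norm_num)]
    have : Real.log 4 = 2 * Real.log 2 := by
      rw [show (4:ℝ) = 2 ^ 2 by norm_num, Real.log_pow]; norm_num
    linarith
  linarith

/-- norm `‖s^(-θ)a‖_{F(u,∞)} ≲ u^(-θ)a(u)` -/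
lemma right_norm (F : RITildeNorm) {a : ℝ → ℝ} (ha : SVP a) {θ : ℝ} (hθ : 0 < θ) :
    ∃ C : ℝ≥0∞, C ≠ ∞ ∧ ∀ u, 0 < u → F.N ((Set.Ioi u).indicator fun s => ENNReal.ofReal (s ^ (-θ) * a s))
      ≤ C * F.kap * ENNReal.ofReal (u ^ (-θ) * a u) := by
  obtain ⟨C, hC, h⟩ := ha.right hθ
  obtain ⟨C2, hC2, h2⟩ := F.expo (θ/2) (by positivity)
  refine ⟨ENNReal.ofReal C * C2, ENNReal.mul_ne_top (by simp) hC2, fun u hu => ?_⟩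
  calc _ ≤ F.N (fun s => (ENNReal.ofReal C * ENNReal.ofReal (u ^ (-θ) * a u)) *
        ENNReal.ofReal (Real.exp (-(θ/2) * dd s u))) := by
        apply F.mono
        intro s _
        by_cases hsu : s ∈ Set.Ioi u
        · rw [Set.indicator_of_mem hsu, mul_right_comm, ← ENNReal.ofReal_mul hC.le,
            ← ENNReal.ofReal_mul (by positivity)]
          exact ENNReal.ofReal_le_ofReal (h s u hu (le_of_lt hsu))
        · simp [hsu]
    _ ≤ (ENNReal.ofReal C * ENNReal.ofReal (u ^ (-θ) * a u)) * (C2 * F.kap) := by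
        rw [F.smul']; gcongr; exact h2 u hu
    _ = _ := by ring

lemma left_norm (F : RITildeNorm) {a : ℝ → ℝ} (ha : SVP a) {θ : ℝ} (hθ : θ < 1) :
    ∃ C : ℝ≥0∞, C ≠ ∞ ∧ ∀ u, 0 < u →
      F.N ((Set.Iic u).indicator fun s => ENNReal.ofReal (s / u * (s ^ (-θ) * a s)))
      ≤ C * F.kap * ENNReal.ofReal (u ^ (-θ) * a u) := by
  obtain ⟨C, hC, h⟩ := ha.left hθ
  obtain ⟨C2, hC2, h2⟩ := F.expo ((1-θ)/2) (by linarith)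
  refine ⟨ENNReal.ofReal C * C2, ENNReal.mul_ne_top (by simp) hC2, fun u hu => ?_⟩
  calc _ ≤ F.N (fun s => (ENNReal.ofReal C * ENNReal.ofReal (u ^ (-θ) * a u)) *
        ENNReal.ofReal (Real.exp (-((1-θ)/2) * dd s u))) := by
        apply F.mono
        intro s hs
        by_cases hsu : s ∈ Set.Iic u
        · rw [Set.indicator_of_mem hsu, mul_right_comm, ← ENNReal.ofReal_mul hC.le,
            ← ENNReal.ofReal_mul (by positivity)]
          exact ENNReal.ofReal_le_ofReal (h s u hs hsu)
        · simp [hsu]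
    _ ≤ (ENNReal.ofReal C * ENNReal.ofReal (u ^ (-θ) * a u)) * (C2 * F.kap) := by
        rw [F.smul']; gcongr; exact h2 u hu
    _ = _ := by ring

/-- lower bound over `(u,∞)` -/
lemma lower_norm (F : RITildeNorm) {a : ℝ → ℝ} (ha : SVP a) (θ : ℝ) :
    ∃ C : ℝ≥0∞, C ≠ ∞ ∧ ∀ (k : ℝ → ℝ≥0∞), (∀ s u, u ≤ s → k u ≤ k s) → ∀ u, 0 < u →
      ENNReal.ofReal (u ^ (-θ) * a u) * k u * F.kap ≤
      C * F.N ((Set.Ioi u).indicator fun s => ENNReal.ofReal (s ^ (-θ) * a s) * k s) := by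
  obtain ⟨C, L, hC, hL, h⟩ := ha.pb θ
  refine ⟨ENNReal.ofReal (C * Real.exp (L * (2 * Real.log 2))), by simp, fun k hk u hu => ?_⟩
  rw [← F.smul']
  apply F.lower (2 * u) (by positivity)
  intro s hs
  have h1 : u < s := by have := hs.1; linarith
  rw [Set.indicator_of_mem (show s ∈ Set.Ioi u from h1), ← mul_assoc]
  apply mul_le_mul' _ (hk s u h1.le)
  rw [← ENNReal.ofReal_mul (by positivity)]
  apply ENNReal.ofReal_le_ofReal
  refine (h u s hu (hu.trans h1)).trans ?_
  have h2 := dd_JJ2 hu hs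
  have h3 : 0 ≤ s ^ (-θ) * a s := mul_nonneg (Real.rpow_nonneg (hu.trans h1).le _) (ha.1 s (hu.trans h1)).le
  gcongr

/-- lower bound over `(0,u)` -/
lemma W_lower (E1 : RITildeNorm) {b1 : ℝ → ℝ} (hb : SVP b1) :
    ∃ C : ℝ≥0∞, C ≠ ∞ ∧ ∀ u, 0 < u → ENNReal.ofReal (b1 u) * E1.kap ≤
      C * svNorm E1 (Set.Ioo 0 u) b1 := by
  obtain ⟨C, hC, h⟩ := hb.2 1 one_pos
  refine ⟨ENNReal.ofReal (C * Real.exp (1 * (3 * Real.log 2))), by simp, fun u hu => ?_⟩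
  unfold svNorm RITildeNorm.on
  rw [← E1.smul']
  apply E1.lower (u / 4) (by positivity)
  intro s hs
  have h0 : 0 < s := lt_of_lt_of_le (by positivity) hs.1
  have h1 : s < u := by have := hs.2; linarith
  rw [Set.indicator_of_mem (show s ∈ Set.Ioo 0 u from ⟨h0, h1⟩)]
  rw [← ENNReal.ofReal_mul (by positivity)]
  apply ENNReal.ofReal_le_ofReal
  refine (h u s hu h0).trans ?_
  have h2 := dd_JJ4 hu hs
  have h3 := hb.1 s h0
  gcongr

/-- `‖b1‖_{E1(0,u)}` behaves as a slowly varying function -/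
lemma W_sv (E1 : RITildeNorm) {b1 : ℝ → ℝ} (hb : SVP b1) (ε : ℝ) (hε : 0 < ε) :
    ∃ C : ℝ, 0 < C ∧ ∀ s u, 0 < s → 0 < u → svNorm E1 (Set.Ioo 0 s) b1 ≤
      ENNReal.ofReal (C * Real.exp (ε * dd s u)) * svNorm E1 (Set.Ioo 0 u) b1 := by
  obtain ⟨C1, hC1, h1⟩ := W_lower E1 hb
  obtain ⟨C2, hC2, h2⟩ := hb.2 ε hε
  obtain ⟨C3, hC3, h3⟩ := E1.expo ε hε
  refine ⟨1 + C2 * (C3.toReal * C1.toReal), by positivity, fun s u hs hu => ?_⟩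
  set W := fun u => svNorm E1 (Set.Ioo 0 u) b1 with hW
  have hex : 1 ≤ Real.exp (ε * dd s u) := Real.one_le_exp (mul_nonneg hε.le (dd_nonneg _ _))
  have hC : ENNReal.ofReal ((1 + C2 * (C3.toReal * C1.toReal)) * Real.exp (ε * dd s u)) =
      ENNReal.ofReal (Real.exp (ε * dd s u)) +
      ENNReal.ofReal (C2 * Real.exp (ε * dd s u)) * (C3 * C1) := by
    rw [← ENNReal.ofReal_toReal hC3, ← ENNReal.ofReal_toReal hC1,
      ← ENNReal.ofReal_mul (by positivity), ← ENNReal.ofReal_mul (by positivity),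
      ← ENNReal.ofReal_add (by positivity) (by positivity)]
    simp only [ENNReal.toReal_ofReal ENNReal.toReal_nonneg]
    congr 1; ring
  have hone : (1:ℝ≥0∞) ≤ ENNReal.ofReal (Real.exp (ε * dd s u)) := by
    rw [← ENNReal.ofReal_one]; exact ENNReal.ofReal_le_ofReal hex
  rcases le_total s u with hsu | hsu
  · have : W s ≤ W u := by
      apply E1.mono
      intro t _
      apply Set.indicator_le_indicator_of_subset (Set.Ioo_subset_Ioo_right hsu)
      intro; exact zero_le
    calc W s ≤ 1 * W u := by simpa using this
      _ ≤ _ := by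
        gcongr
        rw [hC]
        exact hone.trans le_self_add
  · have : W s ≤ W u + E1.N (fun t => (ENNReal.ofReal (C2 * Real.exp (ε * dd s u)) * ENNReal.ofReal (b1 u)) *
        ENNReal.ofReal (Real.exp (-ε * dd t s))) := by
      refine le_trans (E1.mono _ _ ?_) (E1.add_le _ _)
      intro t ht
      by_cases hts : t < s
      · rw [Set.indicator_of_mem (show t ∈ Set.Ioo 0 s from ⟨ht, hts⟩)]
        by_cases htu : t < u
        · rw [Set.indicator_of_mem (show t ∈ Set.Ioo 0 u from ⟨ht, htu⟩)]
          exact le_self_add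
        · refine le_trans ?_ le_add_self
          push Not at htu
          rw [← ENNReal.ofReal_mul (by positivity),
            ← ENNReal.ofReal_mul (mul_nonneg (by positivity) (hb.1 u hu).le)]
          apply ENNReal.ofReal_le_ofReal
          refine (h2 t u ht hu).trans (le_of_eq ?_)
          have : dd t u = dd s u - dd t s := by
            rw [dd_comm t u, dd_comm s u, dd_of_le hu htu, dd_of_le hu hsu, dd_of_le ht hts.le]
            ring
          rw [this, show ε * (dd s u - dd t s) = ε * dd s u + -ε * dd t s by ring, Real.exp_add]
          ring
      · have : t ∉ Set.Ioo 0 s := fun h => hts h.2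
        simp [this]
    refine this.trans ?_
    rw [E1.smul', hC, add_mul]
    apply add_le_add
    · calc W u = 1 * W u := by simp
        _ ≤ _ := by gcongr
    · calc _ ≤ (ENNReal.ofReal (C2 * Real.exp (ε * dd s u)) * ENNReal.ofReal (b1 u)) * (C3 * E1.kap) := by
            gcongr; exact h3 s hs
        _ = (ENNReal.ofReal (C2 * Real.exp (ε * dd s u)) * C3) * (ENNReal.ofReal (b1 u) * E1.kap) := by ring
        _ ≤ (ENNReal.ofReal (C2 * Real.exp (ε * dd s u)) * C3) * (C1 * W u) := by
            exact mul_le_mul' le_rfl (h1 u hu)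
        _ = _ := by ring

section KK
set_option linter.unusedSectionVars false
variable {V : Type*} [AddCommGroup V] [Module ℝ V]

lemma IsQuasiNorm.zero' {N : V → ℝ≥0∞} (h : IsQuasiNorm N) : N 0 = 0 := by
  have := h.smul 0 0
  simpa using this

lemma IsQuasiNorm.neg' {N : V → ℝ≥0∞} (h : IsQuasiNorm N) (x : V) : N (-x) = N x := by
  have := h.smul (-1) x
  simpa using this

lemma K_mono (N0 N1 : V → ℝ≥0∞) (f : V) {t s : ℝ} (h : t ≤ s) : Kfun N0 N1 t f ≤ Kfun N0 N1 s f := by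
  unfold Kfun
  gcongr

lemma K_le_N0 {N0 N1 : V → ℝ≥0∞} (h1 : N1 0 = 0) (t : ℝ) (f : V) : Kfun N0 N1 t f ≤ N0 f := by
  refine (iInf_le _ f).trans ?_
  simp [h1]

lemma K_le_N1 {N0 N1 : V → ℝ≥0∞} (h0 : N0 0 = 0) (t : ℝ) (f : V) :
    Kfun N0 N1 t f ≤ ENNReal.ofReal t * N1 f := by
  refine (iInf_le _ 0).trans ?_
  simp [h0]

lemma K_scale (N0 N1 : V → ℝ≥0∞) (f : V) (s u : ℝ) (hs : 0 < s) (hu : 0 < u) :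
    Kfun N0 N1 s f ≤ ENNReal.ofReal (Real.exp (dd s u)) * Kfun N0 N1 u f := by
  have hpos : 0 < Real.exp (dd s u) := Real.exp_pos _
  unfold Kfun
  rw [ENNReal.mul_iInf_of_ne (by simpa using hpos) (by simp)]
  refine le_iInf fun g => (iInf_le _ g).trans ?_
  rw [mul_add]
  apply add_le_add
  · calc N0 g = 1 * N0 g := by simp
      _ ≤ _ := by
        gcongr
        rw [← ENNReal.ofReal_one]
        exact ENNReal.ofReal_le_ofReal (Real.one_le_exp (dd_nonneg _ _))
  · rw [← mul_assoc, ← ENNReal.ofReal_mul hpos.le]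
    gcongr
    have : s = Real.exp (Real.log s - Real.log u) * u := by
      rw [Real.exp_sub, Real.exp_log hs, Real.exp_log hu]; field_simp
    calc s = Real.exp (Real.log s - Real.log u) * u := this
      _ ≤ _ := by
        gcongr
        exact le_abs_self _

lemma K_add {N0 N1 : V → ℝ≥0∞} (h0 : IsQuasiNorm N0) (h1 : IsQuasiNorm N1) :
    ∃ C : ℝ≥0∞, C ≠ ∞ ∧ 1 ≤ C ∧ ∀ (s : ℝ) (f g : V), Kfun N0 N1 s (f + g) ≤
      C * (Kfun N0 N1 s f + Kfun N0 N1 s g) := by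
  obtain ⟨C0, hC0, hC0', h0⟩ := h0.quasi_triangle
  obtain ⟨C1, hC1, hC1', h1⟩ := h1.quasi_triangle
  have hne : max C0 C1 ≠ ∞ := by
    rcases max_choice C0 C1 with h | h <;> rw [h] <;> assumption
  refine ⟨max C0 C1, hne, le_max_of_le_left hC0, fun s f g => ?_⟩
  have hpos : max C0 C1 ≠ 0 := (lt_of_lt_of_le one_pos (le_max_of_le_left hC0)).ne'
  unfold Kfun
  rw [ENNReal.iInf_add, ENNReal.mul_iInf_of_ne hpos hne]
  refine le_iInf fun x => ?_
  rw [ENNReal.add_iInf, ENNReal.mul_iInf_of_ne hpos hne]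
  refine le_iInf fun y => (iInf_le _ (x + y)).trans ?_
  have e : f + g - (x + y) = (f - x) + (g - y) := by abel
  rw [e]
  calc _ ≤ C0 * (N0 x + N0 y) + ENNReal.ofReal s * (C1 * (N1 (f - x) + N1 (g - y))) := by
        gcongr
        · exact h0 _ _
        · exact h1 _ _
    _ ≤ max C0 C1 * (N0 x + N0 y) + ENNReal.ofReal s * (max C0 C1 * (N1 (f - x) + N1 (g - y))) := by
        gcongr
        · exact le_max_left _ _
        · exact le_max_right _ _
    _ = _ := by ring

lemma K_opt (N0 N1 : V → ℝ≥0∞) (u : ℝ) (f : V) (h : Kfun N0 N1 u f ≠ 0) :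
    ∃ g, N0 g + ENNReal.ofReal u * N1 (f - g) ≤ 2 * Kfun N0 N1 u f := by
  by_cases ht : Kfun N0 N1 u f = ∞
  · exact ⟨0, by rw [ht]; simp⟩
  · have : Kfun N0 N1 u f < 2 * Kfun N0 N1 u f := by
      rw [two_mul]
      exact ENNReal.lt_add_right ht h
    obtain ⟨g, hg⟩ := iInf_lt_iff.1 this
    exact ⟨g, hg.le⟩

def Phi (θ : ℝ) (a : ℝ → ℝ) (F : RITildeNorm) (N0 N1 : V → ℝ≥0∞) (f : V) (t : ℝ) : ℝ≥0∞ :=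
  F.on (Set.Ioi t) (fun s => ENNReal.ofReal (s ^ (-θ) * a s) * Kfun N0 N1 s f)

def Psi (θ : ℝ) (b1 : ℝ → ℝ) (E1 : RITildeNorm) (a : ℝ → ℝ) (F : RITildeNorm) (N0 N1 : V → ℝ≥0∞)
    (f : V) (u : ℝ) : ℝ≥0∞ :=
  E1.on (Set.Ioi u) (fun t => ENNReal.ofReal (b1 t) * Phi θ a F N0 N1 f t)

lemma Phi_anti (θ : ℝ) (a : ℝ → ℝ) (F : RITildeNorm) (N0 N1 : V → ℝ≥0∞) (f : V) {t u : ℝ}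
    (h : t ≤ u) : Phi θ a F N0 N1 f u ≤ Phi θ a F N0 N1 f t := by
  apply F.mono
  intro s _
  apply Set.indicator_le_indicator_of_subset (Set.Ioi_subset_Ioi h)
  intro; exact zero_le

lemma H_upper {N0 N1 : V → ℝ≥0∞} (hN0 : IsQuasiNorm N0) (hN1 : IsQuasiNorm N1)
    (θ : ℝ) (hθ' : θ < 1) (E1 F : RITildeNorm) {a : ℝ → ℝ} (b1 : ℝ → ℝ)
    (ha : SVP a) (hF0 : F.kap ≠ 0) (hF1 : F.kap ≠ ∞) :
    ∃ C : ℝ≥0∞, C ≠ ∞ ∧ ∀ (f : V) (u r : ℝ), 0 < u → 0 < r →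
      ENNReal.ofReal r * ENNReal.ofReal (u ^ (-θ) * a u) * svNorm E1 (Set.Ioo 0 u) b1 = 1 →
      Kfun N0 (spaceNormR θ b1 E1 a F N0 N1) r f ≤
        C * (ENNReal.ofReal r * (svNorm E1 (Set.Ioo 0 u) b1 * Phi θ a F N0 N1 f u +
          Psi θ b1 E1 a F N0 N1 f u)) := by
  obtain ⟨Ca, hCa, hCa1, hadd⟩ := K_add hN0 hN1
  obtain ⟨Cl, hCl, hleft⟩ := left_norm F ha hθ'
  obtain ⟨Cw, hCw, hlow⟩ := lower_norm F ha θ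
  set D : ℝ≥0∞ := 2 * Cl * Cw + 3 * Ca with hD
  have hDt : D ≠ ∞ := by
    rw [hD]
    exact ENNReal.add_ne_top.2 ⟨ENNReal.mul_ne_top (ENNReal.mul_ne_top (by simp) hCl) hCw,
      ENNReal.mul_ne_top (by simp) hCa⟩
  refine ⟨2 * Cw * F.kap⁻¹ + D, ENNReal.add_ne_top.2 ⟨ENNReal.mul_ne_top
    (ENNReal.mul_ne_top (by simp) hCw) (ENNReal.inv_ne_top.2 hF0), hDt⟩, fun f u r hu hr hrw => ?_⟩
  by_cases hK0 : Kfun N0 N1 u f = 0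
  · -- degenerate case
    have hK : ∀ s, 0 < s → Kfun N0 N1 s f = 0 := by
      intro s hs
      have := K_scale N0 N1 f s u hs hu
      rw [hK0, mul_zero] at this
      exact le_antisymm this zero_le
    have hPhi : ∀ t, 0 < t → Phi θ a F N0 N1 f t = 0 := by
      intro t ht
      rw [← F.zero']
      apply F.eq_on
      intro s hs
      simp [hK s hs, Set.indicator]
    have hN : spaceNormR θ b1 E1 a F N0 N1 f = 0 := by
      rw [← E1.zero']
      apply E1.eq_on
      intro t ht
      have := hPhi t ht
      unfold Phi at this
      rw [this, mul_zero]
    refine (K_le_N1 hN0.zero' r f).trans ?_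
    rw [hN]
    simp
  · obtain ⟨g, hg⟩ := K_opt N0 N1 u f hK0
    set k := Kfun N0 N1 u f with hk
    set w := ENNReal.ofReal (u ^ (-θ) * a u) with hw
    set W := svNorm E1 (Set.Ioo 0 u) b1 with hW
    set P := Phi θ a F N0 N1 f with hP
    have hg0 : N0 g ≤ 2 * k := le_self_add.trans hg
    have hg1 : ENNReal.ofReal u * N1 (f - g) ≤ 2 * k := le_add_self.trans hg
    have hwk : w * k * F.kap ≤ Cw * P u :=
      hlow (fun s => Kfun N0 N1 s f) (fun s u h => K_mono _ _ _ h) u hu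
    -- K bounds for f - g
    have hKs : ∀ s, 0 < s → s ≤ u → Kfun N0 N1 s (f - g) ≤ ENNReal.ofReal (s / u) * (2 * k) := by
      intro s hs _
      refine (K_le_N1 hN0.zero' s _).trans ?_
      calc ENNReal.ofReal s * N1 (f - g) = ENNReal.ofReal (s / u) * (ENNReal.ofReal u * N1 (f - g)) := by
            rw [← mul_assoc, ← ENNReal.ofReal_mul (by positivity)]
            congr 2; field_simp
        _ ≤ _ := by gcongr
    have hKl : ∀ s, u ≤ s → Kfun N0 N1 s (f - g) ≤ 3 * Ca * Kfun N0 N1 s f := by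
      intro s hus
      rw [sub_eq_add_neg]
      refine (hadd s f (-g)).trans ?_
      have h1 : Kfun N0 N1 s (-g) ≤ 2 * Kfun N0 N1 s f := by
        refine (K_le_N0 hN1.zero' s _).trans ?_
        rw [hN0.neg']
        refine hg0.trans ?_
        gcongr
        exact K_mono _ _ _ hus
      calc _ ≤ Ca * (Kfun N0 N1 s f + 2 * Kfun N0 N1 s f) := by gcongr
        _ = _ := by ring
    -- Phi bounds
    have hPl : ∀ t, u ≤ t → Phi θ a F N0 N1 (f - g) t ≤ 3 * Ca * P t := by
      intro t hut
      unfold Phi RITildeNorm.on at *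
      rw [hP, ← F.smul']
      apply F.mono
      intro s hs
      by_cases hst : s ∈ Set.Ioi t
      · simp only [Set.indicator_of_mem hst]
        rw [mul_left_comm]
        exact mul_le_mul' le_rfl (hKl s (hut.trans (le_of_lt hst)))
      · simp [hst]
    have hPs : ∀ t, 0 < t → Phi θ a F N0 N1 (f - g) t ≤ D * P u := by
      intro t ht
      calc Phi θ a F N0 N1 (f - g) t ≤ F.N (fun s => (2 * k) * (Set.Iic u).indicator
            (fun s => ENNReal.ofReal (s / u * (s ^ (-θ) * a s))) s + (3 * Ca) *
            (Set.Ioi u).indicator (fun s => ENNReal.ofReal (s ^ (-θ) * a s) * Kfun N0 N1 s f) s) := by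
            apply F.mono
            intro s hs
            refine (Set.indicator_le_self _ _ s).trans ?_
            rcases le_or_gt s u with hsu | hsu
            · refine le_trans ?_ le_self_add
              rw [Set.indicator_of_mem (show s ∈ Set.Iic u from hsu)]
              refine (mul_le_mul' le_rfl (hKs s hs hsu)).trans (le_of_eq ?_)
              rw [ENNReal.ofReal_mul (p := s / u) (by positivity)]
              ring
            · refine le_trans ?_ le_add_self
              rw [Set.indicator_of_mem (show s ∈ Set.Ioi u from hsu), mul_left_comm]
              exact mul_le_mul' le_rfl (hKl s hsu.le)
        _ ≤ (2 * k) * (Cl * F.kap * w) + 3 * Ca * P u := by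
            refine (F.add_le _ _).trans ?_
            rw [F.smul', F.smul']
            gcongr
            · exact hleft u hu
            · exact le_rfl
        _ = 2 * Cl * (w * k * F.kap) + 3 * Ca * P u := by ring
        _ ≤ 2 * Cl * (Cw * P u) + 3 * Ca * P u := by gcongr
        _ = D * P u := by rw [hD]; ring
    have hN : spaceNormR θ b1 E1 a F N0 N1 (f - g) ≤ D * (W * P u + Psi θ b1 E1 a F N0 N1 f u) := by
      calc spaceNormR θ b1 E1 a F N0 N1 (f - g) ≤ E1.N (fun t => (D * P u) *
            (Set.Ioo 0 u).indicator (fun t => ENNReal.ofReal (b1 t)) t + D *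
            (Set.Ioi u).indicator (fun t => ENNReal.ofReal (b1 t) * P t) t) := by
            apply E1.mono_off u
            intro t ht htu
            rcases lt_or_gt_of_ne htu with h | h
            · refine le_trans ?_ le_self_add
              rw [Set.indicator_of_mem (show t ∈ Set.Ioo 0 u from ⟨ht, h⟩), mul_comm]
              exact mul_le_mul' (hPs t ht) le_rfl
            · refine le_trans ?_ le_add_self
              rw [Set.indicator_of_mem (show t ∈ Set.Ioi u from h), mul_left_comm]
              refine mul_le_mul' le_rfl ((hPl t h.le).trans ?_)
              gcongr
              exact le_add_self
        _ ≤ (D * P u) * W + D * Psi θ b1 E1 a F N0 N1 f u := by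
            refine (E1.add_le _ _).trans ?_
            rw [E1.smul', E1.smul']
            exact le_rfl
        _ = _ := by ring
    have hg0' : N0 g ≤ 2 * Cw * F.kap⁻¹ * (ENNReal.ofReal r * (W * P u)) := by
      calc N0 g ≤ 2 * k := hg0
        _ = 2 * k * (ENNReal.ofReal r * w * W) * (F.kap * F.kap⁻¹) := by
            rw [hrw, ENNReal.mul_inv_cancel hF0 hF1]; simp
        _ = 2 * F.kap⁻¹ * (ENNReal.ofReal r * W) * (w * k * F.kap) := by ring
        _ ≤ 2 * F.kap⁻¹ * (ENNReal.ofReal r * W) * (Cw * P u) := by gcongr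
        _ = _ := by ring
    calc Kfun N0 (spaceNormR θ b1 E1 a F N0 N1) r f
        ≤ N0 g + ENNReal.ofReal r * spaceNormR θ b1 E1 a F N0 N1 (f - g) := iInf_le _ g
      _ ≤ 2 * Cw * F.kap⁻¹ * (ENNReal.ofReal r * (W * P u)) +
          ENNReal.ofReal r * (D * (W * P u + Psi θ b1 E1 a F N0 N1 f u)) := by gcongr
      _ ≤ 2 * Cw * F.kap⁻¹ * (ENNReal.ofReal r * (W * P u + Psi θ b1 E1 a F N0 N1 f u)) +
          ENNReal.ofReal r * (D * (W * P u + Psi θ b1 E1 a F N0 N1 f u)) := by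
          gcongr; exact le_self_add
      _ = _ := by ring

lemma H_lower {N0 N1 : V → ℝ≥0∞} (hN0 : IsQuasiNorm N0) (hN1 : IsQuasiNorm N1)
    (θ : ℝ) (hθ : 0 < θ) (E1 F : RITildeNorm) {a b1 : ℝ → ℝ}
    (ha : SVP a) (hb1 : SVP b1) (hF1 : F.kap ≠ ∞) :
    ∃ C : ℝ≥0∞, C ≠ ∞ ∧ ∀ (f : V) (u r : ℝ), 0 < u → 0 < r →
      ENNReal.ofReal r * ENNReal.ofReal (u ^ (-θ) * a u) * svNorm E1 (Set.Ioo 0 u) b1 = 1 →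
        ENNReal.ofReal r * (svNorm E1 (Set.Ioo 0 u) b1 * Phi θ a F N0 N1 f u +
          Psi θ b1 E1 a F N0 N1 f u) ≤ C * Kfun N0 (spaceNormR θ b1 E1 a F N0 N1) r f := by
  obtain ⟨Ca, hCa, hCa1, hadd⟩ := K_add hN0 hN1
  obtain ⟨Cr, hCr, hright⟩ := right_norm F ha hθ
  obtain ⟨Cq, hCq, hright1⟩ := right_norm E1 (ha.mul hb1) hθ
  obtain ⟨Cw, hCw, hlow⟩ := W_lower E1 hb1
  set T : ℝ≥0∞ := Cr * F.kap with hT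
  have hTt : T ≠ ∞ := ENNReal.mul_ne_top hCr hF1
  set C : ℝ≥0∞ := Ca * (T + T * Cq * Cw + 2) with hC
  have hCt : C ≠ ∞ := by
    rw [hC]
    refine ENNReal.mul_ne_top hCa (ENNReal.add_ne_top.2 ⟨ENNReal.add_ne_top.2 ⟨hTt, ?_⟩, by simp⟩)
    exact ENNReal.mul_ne_top (ENNReal.mul_ne_top hTt hCq) hCw
  have hC0 : C ≠ 0 := by
    rw [hC]
    refine mul_ne_zero (lt_of_lt_of_le one_pos hCa1).ne' ?_
    simp
  refine ⟨C, hCt, fun f u r hu hr hrw => ?_⟩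
  rw [Kfun, ENNReal.mul_iInf_of_ne hC0 hCt]
  refine le_iInf fun g => ?_
  set w : ℝ → ℝ≥0∞ := fun u => ENNReal.ofReal (u ^ (-θ) * a u) with hw
  set W := svNorm E1 (Set.Ioo 0 u) b1 with hW
  set P := Phi θ a F N0 N1 f with hP
  set H := Phi θ a F N0 N1 (f - g) with hH
  set NH := spaceNormR θ b1 E1 a F N0 N1 (f - g) with hNH
  have hNHe : NH = E1.N (fun t => ENNReal.ofReal (b1 t) * H t) := rfl
  have hP1 : ∀ t, 0 < t → P t ≤ Ca * (T * N0 g * w t + H t) := by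
    intro t ht
    calc P t ≤ F.N (fun s => (Ca * N0 g) * (Set.Ioi t).indicator w s +
          Ca * (Set.Ioi t).indicator (fun s => w s * Kfun N0 N1 s (f - g)) s) := by
          apply F.mono
          intro s _
          by_cases hst : s ∈ Set.Ioi t
          · simp only [Set.indicator_of_mem hst]
            have h1 : Kfun N0 N1 s f ≤ Ca * (N0 g + Kfun N0 N1 s (f - g)) := by
              have := hadd s g (f - g)
              rw [add_sub_cancel] at this
              refine this.trans ?_
              gcongr
              exact K_le_N0 hN1.zero' s g
            refine (mul_le_mul' le_rfl h1).trans (le_of_eq ?_)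
            ring
          · simp [hst]
      _ ≤ (Ca * N0 g) * (Cr * F.kap * w t) + Ca * H t := by
          refine (F.add_le _ _).trans ?_
          rw [F.smul', F.smul']
          gcongr
          · exact hright t ht
          · exact le_rfl
      _ = _ := by rw [hT]; ring
  have hWH : W * H u ≤ NH := by
    rw [hNHe, mul_comm, hW, svNorm, RITildeNorm.on, ← E1.smul']
    apply E1.mono
    intro t ht
    by_cases htu : t ∈ Set.Ioo 0 u
    · rw [Set.indicator_of_mem htu, mul_comm]
      exact mul_le_mul' le_rfl (Phi_anti _ _ _ _ _ _ htu.2.le)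
    · simp [htu]
  have hPsi : Psi θ b1 E1 a F N0 N1 f u ≤ Ca * T * N0 g * (Cq * Cw * (w u * W)) + Ca * NH := by
    calc Psi θ b1 E1 a F N0 N1 f u ≤ E1.N (fun t => (Ca * T * N0 g) * (Set.Ioi u).indicator
          (fun s => ENNReal.ofReal (s ^ (-θ) * (a s * b1 s))) t + Ca * (ENNReal.ofReal (b1 t) * H t)) := by
          apply E1.mono
          intro t ht
          by_cases htu : t ∈ Set.Ioi u
          · simp only [Set.indicator_of_mem htu]
            refine (mul_le_mul' le_rfl (hP1 t ht)).trans (le_of_eq ?_)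
            have : ENNReal.ofReal (t ^ (-θ) * (a t * b1 t)) = w t * ENNReal.ofReal (b1 t) := by
              rw [hw, ← ENNReal.ofReal_mul (mul_nonneg (by positivity) (ha.1 t ht).le)]
              congr 1; ring
            rw [this]
            ring
          · simp [htu]
      _ ≤ (Ca * T * N0 g) * (Cq * E1.kap * ENNReal.ofReal (u ^ (-θ) * (a u * b1 u))) + Ca * NH := by
          refine (E1.add_le _ _).trans ?_
          rw [E1.smul', E1.smul']
          gcongr
          · exact hright1 u hu
          · exact le_rfl
      _ = (Ca * T * N0 g) * (Cq * w u * (ENNReal.ofReal (b1 u) * E1.kap)) + Ca * NH := by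
          have : ENNReal.ofReal (u ^ (-θ) * (a u * b1 u)) = w u * ENNReal.ofReal (b1 u) := by
            rw [hw, ← ENNReal.ofReal_mul (mul_nonneg (by positivity) (ha.1 u hu).le)]
            congr 1; ring
          rw [this]; ring
      _ ≤ (Ca * T * N0 g) * (Cq * w u * (Cw * W)) + Ca * NH := by
          refine add_le_add (mul_le_mul' le_rfl (mul_le_mul' le_rfl ?_)) le_rfl
          exact hlow u hu
      _ = _ := by ring
  set R := ENNReal.ofReal r with hR
  have hrw' : R * w u * W = 1 := hrw
  calc R * (W * P u + Psi θ b1 E1 a F N0 N1 f u)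
      ≤ R * (W * (Ca * (T * N0 g * w u + H u)) +
        (Ca * T * N0 g * (Cq * Cw * (w u * W)) + Ca * NH)) := by
        gcongr
        exact hP1 u hu
    _ = Ca * T * N0 g * (R * w u * W) + Ca * R * (W * H u) +
        Ca * T * Cq * Cw * N0 g * (R * w u * W) + Ca * R * NH := by ring
    _ ≤ Ca * T * N0 g * (R * w u * W) + Ca * R * NH +
        Ca * T * Cq * Cw * N0 g * (R * w u * W) + Ca * R * NH := by
        gcongr
    _ = Ca * (T + T * Cq * Cw) * N0 g + Ca * 2 * (R * NH) := by rw [hrw']; ring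
    _ ≤ Ca * (T + T * Cq * Cw + 2) * N0 g + Ca * (T + T * Cq * Cw + 2) * (R * NH) := by
        have e1 : T + T * Cq * Cw ≤ T + T * Cq * Cw + 2 := le_self_add
        have e2 : (2:ℝ≥0∞) ≤ T + T * Cq * Cw + 2 := le_add_self
        exact add_le_add (mul_le_mul' (mul_le_mul' le_rfl e1) le_rfl)
          (mul_le_mul' (mul_le_mul' le_rfl e2) le_rfl)
    _ = C * (N0 g + R * NH) := by rw [hC]; ring

end KK

section Deg
set_option linter.unusedSectionVars false
variable {V : Type*} [AddCommGroup V] [Module ℝ V]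

lemma spaceNorm_zero (E : RITildeNorm) (b : ℝ → ℝ) {N0 N : V → ℝ≥0∞} (h0 : N0 0 = 0) {f : V}
    (h : N f = 0) : spaceNorm E 1 b N0 N f = 0 := by
  rw [← E.zero']
  apply E.eq_on
  intro t _
  have : Kfun N0 N t f = 0 := le_antisymm ((K_le_N1 h0 t f).trans (by simp [h])) zero_le
  rw [this, mul_zero]

lemma all_zero {N0 N1 : V → ℝ≥0∞} (hN0 : IsQuasiNorm N0) (θ : ℝ) (E E1 F : RITildeNorm)
    (a b b1 : ℝ → ℝ) (f : V) (hP : ∀ t, 0 < t → Phi θ a F N0 N1 f t = 0) (c d : ℝ → ℝ) :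
    spaceNorm E 1 b N0 (spaceNormR θ b1 E1 a F N0 N1) f = 0 ∧
    spaceNormR θ c E a F N0 N1 f = 0 ∧ spaceNormRR θ d E b1 E1 a F N0 N1 f = 0 := by
  have h1 : ∀ (E : RITildeNorm) (c : ℝ → ℝ), spaceNormR θ c E a F N0 N1 f = 0 := by
    intro E c
    rw [← E.zero']
    apply E.eq_on
    intro t ht
    have := hP t ht
    unfold Phi at this
    rw [this, mul_zero]
  refine ⟨spaceNorm_zero E b hN0.zero' (h1 _ _), h1 _ _, ?_⟩
  rw [← E.zero']
  apply E.eq_on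
  intro u _
  have : Psi θ b1 E1 a F N0 N1 f u = 0 := by
    rw [← E1.zero']
    apply E1.eq_on
    intro t ht
    simp [Set.indicator, hP t ht]
  unfold Psi Phi at this
  rw [this, mul_zero]

lemma K_zero_all (N0 N1 : V → ℝ≥0∞) (f : V) (hK : Kfun N0 N1 1 f = 0) (s : ℝ) (hs : 0 < s) :
    Kfun N0 N1 s f = 0 := by
  have := K_scale N0 N1 f s 1 hs one_pos
  rw [hK, mul_zero] at this
  exact le_antisymm this zero_le

lemma Phi_zero (θ : ℝ) (a : ℝ → ℝ) (F : RITildeNorm) (N0 N1 : V → ℝ≥0∞) (f : V)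
    (hK : Kfun N0 N1 1 f = 0) (t : ℝ) (_ : 0 < t) : Phi θ a F N0 N1 f t = 0 := by
  rw [← F.zero']
  apply F.eq_on
  intro s hs
  simp [K_zero_all N0 N1 f hK s hs, Set.indicator]

lemma Phi_top (θ : ℝ) (F : RITildeNorm) {N0 N1 : V → ℝ≥0∞} {a : ℝ → ℝ} (ha : SVP a)
    (hF1 : F.kap = ∞) (f : V) (hK : Kfun N0 N1 1 f ≠ 0) (t : ℝ) (ht : 0 < t) :
    Phi θ a F N0 N1 f t = ∞ := by
  obtain ⟨C, hC, h⟩ := lower_norm F ha θ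
  have h1 := h (fun s => Kfun N0 N1 s f) (fun s u h => K_mono _ _ _ h) t ht
  have hKt : Kfun N0 N1 t f ≠ 0 := by
    intro h0
    have := K_scale N0 N1 f 1 t one_pos ht
    rw [h0, mul_zero] at this
    exact hK (le_antisymm this zero_le)
  have hw : ENNReal.ofReal (t ^ (-θ) * a t) ≠ 0 := by
    have := mul_pos (Real.rpow_pos_of_pos ht (-θ)) (ha.1 t ht)
    simpa using this
  rw [hF1, ENNReal.mul_top (mul_ne_zero hw hKt), top_le_iff] at h1
  by_contra hc
  exact ENNReal.mul_ne_top hC hc h1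

lemma R_top (θ : ℝ) (E F : RITildeNorm) {N0 N1 : V → ℝ≥0∞} {a : ℝ → ℝ} (ha : SVP a)
    (hE0 : E.kap ≠ 0) (hF1 : F.kap = ∞) (f : V) (hK : Kfun N0 N1 1 f ≠ 0) (c : ℝ → ℝ)
    (hc : ∀ u, 0 < u → 0 < c u) : spaceNormR θ c E a F N0 N1 f = ∞ := by
  have : ∞ * E.kap ≤ E.N (fun t => ENNReal.ofReal (c t) * Phi θ a F N0 N1 f t) := by
    apply E.lower 1 one_pos
    intro t ht
    have ht0 : 0 < t := lt_of_lt_of_le one_pos ht.1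
    rw [Phi_top θ F ha hF1 f hK t ht0, ENNReal.mul_top (by simpa using hc t ht0)]
  rw [ENNReal.top_mul hE0, top_le_iff] at this
  exact this

lemma inv_top (E : RITildeNorm) {b : ℝ → ℝ} (hb : SVP b) (hE0 : E.kap ≠ 0) :
    E.N (fun t => ENNReal.ofReal (t ^ (-(1:ℝ)) * b t)) = ∞ := by
  obtain ⟨C, hC, h⟩ := hb.right one_pos
  have hb1 := hb.1 1 one_pos
  have hl2 : Real.log 2 ≤ 1 := by
    have := Real.log_le_sub_one_of_pos (show (0:ℝ) < 2 by norm_num)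
    linarith
  set c : ℝ := b 1 / (2 * C) with hc
  have hcp : 0 < c := by positivity
  have key : ∀ n : ℕ, (n : ℝ≥0∞) * (ENNReal.ofReal c * E.kap) ≤
      E.N (fun t => ENNReal.ofReal (t ^ (-(1:ℝ)) * b t)) := by
    intro n
    rw [← mul_assoc]
    apply E.lower (Real.exp (-(n + 1))) (Real.exp_pos _)
    intro t ht
    have ht0 : 0 < t := lt_of_lt_of_le (Real.exp_pos _) ht.1
    have hlog : Real.log t ≤ -n := by
      have := Real.log_le_log ht0 ht.2.le
      rw [Real.log_mul (by norm_num) (Real.exp_pos _).ne', Real.log_exp] at this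
      linarith
    have ht1 : t ≤ 1 := by
      rw [← Real.log_nonpos_iff ht0.le]
      have : (0:ℝ) ≤ n := by positivity
      linarith
    have h1 := h 1 t ht0 ht1
    rw [Real.one_rpow, one_mul, dd_comm, dd_of_le ht0 ht1, Real.log_one] at h1
    rw [← ENNReal.ofReal_natCast, ← ENNReal.ofReal_mul (by positivity)]
    apply ENNReal.ofReal_le_ofReal
    have hm : 0 < t ^ (-(1:ℝ)) * b t := mul_pos (Real.rpow_pos_of_pos ht0 _) (hb.1 t ht0)
    set m := t ^ (-(1:ℝ)) * b t with hm'
    have h2 : b 1 * Real.exp (n / 2) ≤ C * m := by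
      calc b 1 * Real.exp (n / 2) ≤ (C * Real.exp (-(1/2) * (0 - Real.log t)) * m) * Real.exp (n / 2) := by
            gcongr
        _ = C * m * Real.exp (-(1/2) * (0 - Real.log t) + n / 2) := by rw [Real.exp_add]; ring
        _ ≤ C * m * 1 := by
            gcongr
            rw [Real.exp_le_one_iff]
            linarith
        _ = _ := by ring
    have h3 : (n:ℝ) / 2 ≤ Real.exp (n / 2) := by
      have := Real.add_one_le_exp ((n:ℝ) / 2)
      linarith
    have h4 : b 1 * ((n:ℝ) / 2) ≤ C * m := le_trans (by gcongr) h2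
    rw [hc, mul_div_assoc', div_le_iff₀ (by positivity)]
    linarith
  have : ∞ * (ENNReal.ofReal c * E.kap) ≤ E.N (fun t => ENNReal.ofReal (t ^ (-(1:ℝ)) * b t)) := by
    rw [← ENNReal.iSup_natCast, ENNReal.iSup_mul]
    exact iSup_le key
  rwa [ENNReal.top_mul (mul_ne_zero (by simpa using hcp) hE0), top_le_iff] at this

lemma L_top {N0 N1 : V → ℝ≥0∞} (hN0 : IsQuasiNorm N0) (hN1 : IsQuasiNorm N1) (θ : ℝ)
    (E E1 F : RITildeNorm) {a b b1 : ℝ → ℝ} (ha : SVP a) (hb : SVP b) (hb1 : SVP b1)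
    (hE0 : E.kap ≠ 0) (hE10 : E1.kap ≠ 0) (hF1 : F.kap = ∞) (f : V) (hK : Kfun N0 N1 1 f ≠ 0) :
    spaceNorm E 1 b N0 (spaceNormR θ b1 E1 a F N0 N1) f = ∞ := by
  obtain ⟨Ca, hCa, hCa1, hadd⟩ := K_add hN0 hN1
  have hCa0 : Ca ≠ 0 := (lt_of_lt_of_le one_pos hCa1).ne'
  set N := spaceNormR θ b1 E1 a F N0 N1 with hN
  have hk : ∀ t, 0 < t → Kfun N0 N1 1 f ≤ Ca * Kfun N0 N t f := by
    intro t ht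
    conv_rhs => rw [Kfun, ENNReal.mul_iInf_of_ne hCa0 hCa]
    refine le_iInf fun g => ?_
    by_cases h0 : Kfun N0 N1 1 (f - g) = 0
    · have h1 := hadd 1 g (f - g)
      rw [add_sub_cancel, h0, add_zero] at h1
      refine h1.trans ?_
      gcongr
      exact (K_le_N0 hN1.zero' 1 g).trans le_self_add
    · have : N (f - g) = ∞ := R_top θ E1 F ha hE10 hF1 (f - g) h0 b1 hb1.1
      rw [this, ENNReal.mul_top (by simpa using ht), add_top, ENNReal.mul_top hCa0]
      exact le_top
  have h2 : Kfun N0 N1 1 f * E.N (fun t => ENNReal.ofReal (t ^ (-(1:ℝ)) * b t)) ≤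
      Ca * spaceNorm E 1 b N0 N f := by
    unfold spaceNorm
    rw [← E.smul', ← E.smul']
    apply E.mono
    intro t ht
    rw [mul_comm, mul_left_comm]
    exact mul_le_mul' le_rfl (hk t ht)
  rw [inv_top E hb hE0, ENNReal.mul_top hK, top_le_iff] at h2
  by_contra hc
  exact ENNReal.mul_ne_top hCa hc h2

lemma W_posfin (E1 : RITildeNorm) {b1 : ℝ → ℝ} (hb1 : SVP b1) (hE10 : E1.kap ≠ 0)
    (hfin : svNorm E1 (Set.Ioo 0 1) b1 < ∞) :
    (∀ u, 0 < u → svNorm E1 (Set.Ioo 0 u) b1 ≠ 0) ∧ ∀ u, 0 < u → svNorm E1 (Set.Ioo 0 u) b1 ≠ ∞ := by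
  obtain ⟨C, hC, h⟩ := W_lower E1 hb1
  obtain ⟨C', hC', h'⟩ := W_sv E1 hb1 1 one_pos
  constructor
  · intro u hu h0
    have := h u hu
    rw [h0, mul_zero] at this
    have h1 : ENNReal.ofReal (b1 u) ≠ 0 := by simpa using hb1.1 u hu
    exact mul_ne_zero h1 hE10 (le_antisymm this zero_le)
  · intro u hu
    exact ne_top_of_le_ne_top (ENNReal.mul_ne_top (by simp) hfin.ne) (h' u 1 hu one_pos)

end Deg

theorem statement13 {V : Type*} [AddCommGroup V] [Module ℝ V]
    (N0 N1 : V → ℝ≥0∞) (hN0 : IsQuasiNorm N0) (hN1 : IsQuasiNorm N1)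
    (θ1 : ℝ) (hθ1 : 0 < θ1) (hθ1' : θ1 < 1)
    (E E1 F : RITildeNorm) (a b b1 : ℝ → ℝ)
    (ha : SlowlyVarying a) (hb : SlowlyVarying b) (hb1 : SlowlyVarying b1)
    (hb1fin : svNorm E1 (Set.Ioo 0 1) b1 < ∞) (hbfin : svNorm E (Set.Ioo 0 1) b < ∞) :
    ∃ C : ℝ, 0 < C ∧ ∀ f : V,
      spaceNorm E 1 b N0 (spaceNormR θ1 b1 E1 a F N0 N1) f ≤ ENNReal.ofReal C * (max (spaceNormR θ1 (fun u => (svNorm E1 (Set.Ioo 0 u) b1).toReal * b (u ^ θ1 / (a u * (svNorm E1 (Set.Ioo 0 u) b1).toReal)))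
          E a F N0 N1 f)
        (spaceNormRR θ1 (fun u => b (u ^ θ1 / (a u * (svNorm E1 (Set.Ioo 0 u) b1).toReal))) E b1 E1 a F N0 N1 f)) ∧
      max (spaceNormR θ1 (fun u => (svNorm E1 (Set.Ioo 0 u) b1).toReal * b (u ^ θ1 / (a u * (svNorm E1 (Set.Ioo 0 u) b1).toReal)))
          E a F N0 N1 f)
        (spaceNormRR θ1 (fun u => b (u ^ θ1 / (a u * (svNorm E1 (Set.Ioo 0 u) b1).toReal))) E b1 E1 a F N0 N1 f) ≤ ENNReal.ofReal C * (spaceNorm E 1 b N0 (spaceNormR θ1 b1 E1 a F N0 N1) f) := by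
  have hav := ha.svp
  have hbv := hb.svp
  have hb1v := hb1.svp
  by_cases hE0 : E.kap = 0
  · refine ⟨1, one_pos, fun f => ?_⟩
    simp [spaceNorm, spaceNormR, spaceNormRR, E.zero_of_kap hE0]
  by_cases hE10 : E1.kap = 0
  · refine ⟨1, one_pos, fun f => ?_⟩
    have h1 : spaceNorm E 1 b N0 (spaceNormR θ1 b1 E1 a F N0 N1) f = 0 :=
      spaceNorm_zero E b hN0.zero' (E1.zero_of_kap hE10 _)
    rw [h1]
    simp [spaceNormR, spaceNormRR, svNorm, RITildeNorm.on, E1.zero_of_kap hE10, E.zero']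
  obtain ⟨hWpos, hWfin⟩ := W_posfin E1 hb1v hE10 hb1fin
  set Wr : ℝ → ℝ := fun u => (svNorm E1 (Set.Ioo 0 u) b1).toReal with hWr
  have hWrW : ∀ u, 0 < u → svNorm E1 (Set.Ioo 0 u) b1 = ENNReal.ofReal (Wr u) := fun u hu =>
    (ENNReal.ofReal_toReal (hWfin u hu)).symm
  have hWrv : SVP Wr := by
    refine ⟨fun t ht => ENNReal.toReal_pos (hWpos t ht) (hWfin t ht), fun ε hε => ?_⟩
    obtain ⟨C, hC, h⟩ := W_sv E1 hb1v ε hε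
    refine ⟨C, hC, fun s u hs hu => ?_⟩
    have := h s u hs hu
    rw [hWrW s hs, hWrW u hu, ← ENNReal.ofReal_mul (by positivity)] at this
    exact (ENNReal.ofReal_le_ofReal_iff (mul_nonneg (by positivity) ENNReal.toReal_nonneg)).1 this
  set ρ : ℝ → ℝ := fun u => u ^ θ1 / (a u * Wr u) with hρ
  have hv : SVP (fun u => a u * Wr u) := hav.mul hWrv
  have hρ0 : ∀ t, 0 < t → 0 < ρ t := fun t ht => div_pos (Real.rpow_pos_of_pos ht _) (hv.1 t ht)
  by_cases hF0 : F.kap = 0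
  · refine ⟨1, one_pos, fun f => ?_⟩
    obtain ⟨h1, h2, h3⟩ := all_zero (N1 := N1) hN0 θ1 E E1 F a b b1 f (fun t _ => F.zero_of_kap hF0 _)
      (fun u => Wr u * b (ρ u)) (fun u => b (ρ u))
    rw [h1, h2, h3]
    simp
  by_cases hF1 : F.kap = ∞
  · refine ⟨1, one_pos, fun f => ?_⟩
    by_cases hK : Kfun N0 N1 1 f = 0
    · obtain ⟨h1, h2, h3⟩ := all_zero (N1 := N1) hN0 θ1 E E1 F a b b1 f (Phi_zero θ1 a F N0 N1 f hK)
        (fun u => Wr u * b (ρ u)) (fun u => b (ρ u))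
      rw [h1, h2, h3]
      simp
    · have hR : spaceNormR θ1 (fun u => Wr u * b (ρ u)) E a F N0 N1 f = ∞ :=
        R_top θ1 E F hav hE0 hF1 f hK _ (fun u hu => mul_pos (hWrv.1 u hu) (hbv.1 _ (hρ0 u hu)))
      have hL := L_top hN0 hN1 θ1 E E1 F hav hbv hb1v hE0 hE10 hF1 f hK
      rw [hR, hL]
      simp
  obtain ⟨C1, hC1, hup⟩ := H_upper hN0 hN1 θ1 hθ1' E1 F b1 hav hF0 hF1
  obtain ⟨C2, hC2, hlo⟩ := H_lower hN0 hN1 θ1 hθ1 E1 F hav hb1v hF1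
  obtain ⟨B, L, hB, hL, hpb⟩ := hbv.pb 1
  obtain ⟨Cv, hCv, hvle⟩ := hv.2 (θ1 / 2) (by positivity)
  have hlogv : ∀ s u, 0 < s → 0 < u → Real.log (a s * Wr s) - Real.log (a u * Wr u) ≤
      |Real.log Cv| + θ1 / 2 * dd s u := by
    intro s u hs hu
    have h1 := Real.log_le_log (hv.1 s hs) (hvle s u hs hu)
    rw [Real.log_mul (x := Cv * Real.exp (θ1 / 2 * dd s u)) (y := a u * Wr u)
        (by positivity) (hv.1 u hu).ne',
      Real.log_mul (x := Cv) (y := Real.exp (θ1 / 2 * dd s u)) hCv.ne' (Real.exp_pos _).ne',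
      Real.log_exp] at h1
    have := le_abs_self (Real.log Cv)
    linarith
  obtain ⟨C3, hC3, hco⟩ := E.coarse ρ hρ0 (|Real.log Cv|) θ1 B (L + 1) (abs_nonneg _) hθ1
    (by positivity) hB.le (by
      intro s u hs hu
      have e : ∀ s, 0 < s → Real.log (ρ s) = θ1 * Real.log s - Real.log (a s * Wr s) := by
        intro s hs
        simp only [hρ]
        rw [Real.log_div (Real.rpow_pos_of_pos hs _).ne' (hv.1 s hs).ne', Real.log_rpow hs]
      rw [e s hs, e u hu, abs_le]
      have h1 := hlogv s u hs hu
      have h2 := hlogv u s hu hs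
      rw [dd_comm] at h2
      constructor <;> linarith)
  set Cst : ℝ≥0∞ := C3 * C1 * 2 + C2 * C3 with hCst
  have hCstt : Cst ≠ ∞ := ENNReal.add_ne_top.2 ⟨ENNReal.mul_ne_top (ENNReal.mul_ne_top hC3 hC1) (by simp),
    ENNReal.mul_ne_top hC2 hC3⟩
  refine ⟨Cst.toReal + 1, by positivity, fun f => ?_⟩
  have hCle : Cst ≤ ENNReal.ofReal (Cst.toReal + 1) := by
    rw [← ENNReal.ofReal_toReal hCstt]
    apply ENNReal.ofReal_le_ofReal
    simp
  set N := spaceNormR θ1 b1 E1 a F N0 N1 with hN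
  set G : ℝ → ℝ≥0∞ := fun t => ENNReal.ofReal (t ^ (-(1:ℝ)) * b t) * Kfun N0 N t f with hG
  obtain ⟨hc1, hc2⟩ := hco G (by
    intro s u hs hu
    have h1 : ENNReal.ofReal (s ^ (-(1:ℝ)) * b s) ≤
        ENNReal.ofReal (B * Real.exp (L * dd s u)) * ENNReal.ofReal (u ^ (-(1:ℝ)) * b u) := by
      rw [← ENNReal.ofReal_mul (by positivity)]
      exact ENNReal.ofReal_le_ofReal (hpb s u hs hu)
    refine (mul_le_mul' h1 (K_scale N0 N f s u hs hu)).trans (le_of_eq ?_)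
    have h2 : ENNReal.ofReal (B * Real.exp ((L + 1) * dd s u)) =
        ENNReal.ofReal (B * Real.exp (L * dd s u)) * ENNReal.ofReal (Real.exp (dd s u)) := by
      rw [← ENNReal.ofReal_mul (by positivity), mul_assoc, ← Real.exp_add]
      congr 3; ring
    rw [h2]
    simp only [hG]
    ring)
  set R1 := spaceNormR θ1 (fun u => Wr u * b (ρ u)) E a F N0 N1 f with hR1
  set R2 := spaceNormRR θ1 (fun u => b (ρ u)) E b1 E1 a F N0 N1 f with hR2
  set X1 : ℝ → ℝ≥0∞ := fun u => ENNReal.ofReal (Wr u * b (ρ u)) * Phi θ1 a F N0 N1 f u with hX1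
  set X2 : ℝ → ℝ≥0∞ := fun u => ENNReal.ofReal (b (ρ u)) * Psi θ1 b1 E1 a F N0 N1 f u with hX2
  have hR1e : R1 = E.N X1 := rfl
  have hR2e : R2 = E.N X2 := rfl
  have hrw : ∀ u, 0 < u → ENNReal.ofReal (ρ u) * ENNReal.ofReal (u ^ (-θ1) * a u) *
      svNorm E1 (Set.Ioo 0 u) b1 = 1 := by
    intro u hu
    have := hav.1 u hu
    have := hWrv.1 u hu
    rw [hWrW u hu, ← ENNReal.ofReal_mul (hρ0 u hu).le, ← ENNReal.ofReal_mul (mul_nonneg (hρ0 u hu).le (by positivity)),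
      ← ENNReal.ofReal_one]
    congr 1
    simp only [hρ]
    rw [Real.rpow_neg hu.le]
    have : 0 < u ^ θ1 := Real.rpow_pos_of_pos hu _
    field_simp
  have hX : ∀ u, 0 < u → ENNReal.ofReal (ρ u ^ (-(1:ℝ)) * b (ρ u)) * (ENNReal.ofReal (ρ u) *
      (svNorm E1 (Set.Ioo 0 u) b1 * Phi θ1 a F N0 N1 f u + Psi θ1 b1 E1 a F N0 N1 f u)) = X1 u + X2 u := by
    intro u hu
    have h0 := hρ0 u hu
    have h1 := hbv.1 _ h0
    rw [← mul_assoc, ← ENNReal.ofReal_mul (by positivity)]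
    have e : ρ u ^ (-(1:ℝ)) * b (ρ u) * ρ u = b (ρ u) := by
      rw [Real.rpow_neg_one]; field_simp
    rw [e, hWrW u hu]
    simp only [hX1, hX2]
    rw [ENNReal.ofReal_mul (hWrv.1 u hu).le]
    ring
  have hGup : ∀ u, 0 < u → G (ρ u) ≤ C1 * (X1 u + X2 u) := by
    intro u hu
    rw [← hX u hu, mul_left_comm]
    exact mul_le_mul' le_rfl (hup f u (ρ u) hu (hρ0 u hu) (hrw u hu))
  have hGlo : ∀ u, 0 < u → X1 u + X2 u ≤ C2 * G (ρ u) := by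
    intro u hu
    rw [← hX u hu]
    refine (mul_le_mul' le_rfl (hlo f u (ρ u) hu (hρ0 u hu) (hrw u hu))).trans (le_of_eq ?_)
    exact mul_left_comm _ _ _
  have hLe : spaceNorm E 1 b N0 N f = E.N G := rfl
  rw [hLe]
  constructor
  · calc E.N G ≤ C3 * E.N (fun u => G (ρ u)) := hc1
      _ ≤ C3 * E.N (fun u => C1 * (X1 u + X2 u)) := by
          gcongr
          exact E.mono _ _ hGup
      _ ≤ C3 * (C1 * (R1 + R2)) := by
          rw [E.smul', hR1e, hR2e]
          gcongr
          exact E.add_le _ _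
      _ ≤ C3 * (C1 * (max R1 R2 + max R1 R2)) := by
          gcongr
          · exact le_max_left _ _
          · exact le_max_right _ _
      _ = C3 * C1 * 2 * max R1 R2 := by ring
      _ ≤ _ := by
          gcongr
          exact le_self_add.trans hCle
  · have h5 : C2 * E.N (fun u => G (ρ u)) ≤ ENNReal.ofReal (Cst.toReal + 1) * E.N G := by
      calc C2 * E.N (fun u => G (ρ u)) ≤ C2 * (C3 * E.N G) := by gcongr
        _ = C2 * C3 * E.N G := by ring
        _ ≤ _ := by
          gcongr
          exact le_add_self.trans hCle
    refine max_le ?_ ?_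
    · refine le_trans ?_ h5
      rw [hR1e, ← E.smul']
      exact E.mono _ _ fun u hu => le_self_add.trans (hGlo u hu)
    · refine le_trans ?_ h5
      rw [hR2e, ← E.smul']
      exact E.mono _ _ fun u hu => le_add_self.trans (hGlo u hu)

end
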